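/- arXiv:2108.10412 — 2 statements merged into one kernel-verified Lean document; each statement's English description precedes it below -/
import Mathlib

section
/- (Key multiplier lemma) Let n ≥ 1, p ∈ (0,∞], a ≥ 0, and let {σ_k}_{k∈ℕ} be a family of C^∞ functions on ℝⁿ for which there exists R > 0 with supp σ_k ⊆ {|ξ| < R} for all k ∈ ℕ. Suppose there exist γ > max{n/p, n} and c > 0 such that for every M > 0 there is a constant C_M with |σ̂_k(x)| ≤ C_M ( ⟨x⟩^{−M} + ⟨x⟩^{−γ} e^{−c 2^{−k} |x|} ) for all k ∈ ℕ and x ∈ ℝⁿ. Then there exists C > 0 such that for every k ∈ ℕ and every h ∈ 𝒮(ℝⁿ): ‖ (2π)^{−n} ∫_{ℝⁿ} σ_k(2^{−k}ξ) Φ(2^{−k}ξ) ĥ(ξ) e^{i ξ·x} dξ ‖_{L^p_{⟨x⟩^a}} ≤ C ‖S_k h‖_{L^p_{⟨x⟩^a}}. -/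
open MeasureTheory Real Complex
open scoped ENNReal NNReal RealInnerProductSpace

noncomputable section

abbrev Eu (n : ℕ) := EuclideanSpace ℝ (Fin n)

/-- The polynomial weight `⟨x⟩^a = (1+|x|²)^{a/2}` as an `ℝ≥0∞`-valued function. -/
def jweight {n : ℕ} (a : ℝ) (x : Eu n) : ℝ≥0∞ :=
  ENNReal.ofReal ((1 + ‖x‖ ^ 2) ^ (a / 2))

/-- Weighted Lebesgue (quasi-)norm `‖f‖_{L^p_{⟨x⟩^a}}`; for `p = ∞` the essential sup norm. -/
def wNorm {n : ℕ} {F : Type*} [NormedAddCommGroup F] (p : ℝ≥0∞) (a : ℝ)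
    (f : Eu n → F) : ℝ≥0∞ :=
  if p = ∞ then essSup (fun x => (‖f x‖₊ : ℝ≥0∞)) volume
  else (∫⁻ x, (‖f x‖₊ : ℝ≥0∞) ^ p.toReal * jweight a x) ^ (1 / p.toReal)

/-- The Fourier transform `f̂(ξ) = ∫ f(x) e^{-i x·ξ} dx`. -/
def FT {n : ℕ} (f : Eu n → ℂ) (ξ : Eu n) : ℂ :=
  ∫ x, f x * Complex.exp (-(Complex.I * ((⟪x, ξ⟫ : ℝ) : ℂ)))

/-- The inhomogeneous fractional derivative (Bessel potential) `J^s`. -/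
def Js {n : ℕ} (s : ℝ) (f : Eu n → ℂ) (x : Eu n) : ℂ :=
  ((((2 * Real.pi) ^ n)⁻¹ : ℝ) : ℂ) *
    ∫ ξ, (((1 + ‖ξ‖ ^ 2) ^ (s / 2) : ℝ) : ℂ) * FT f ξ *
      Complex.exp (Complex.I * ((⟪x, ξ⟫ : ℝ) : ℂ))

/-- A Littlewood–Paley bump: `Φ ∈ C_c^∞(ℝⁿ)` with `0 ≤ Φ ≤ 1`, `Φ = 1` on `|ξ| ≤ 1` and
`Φ = 0` on `|ξ| ≥ 2`. -/
def IsLPBump {n : ℕ} (Φ : Eu n → ℝ) : Prop :=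
  ContDiff ℝ (⊤ : ℕ∞) Φ ∧ (∀ ξ, 0 ≤ Φ ξ ∧ Φ ξ ≤ 1) ∧
    (∀ ξ, ‖ξ‖ ≤ 1 → Φ ξ = 1) ∧ (∀ ξ, 2 ≤ ‖ξ‖ → Φ ξ = 0)

/-- The low-frequency projection `S_k f`, with Fourier multiplier `Φ(2^{-k}ξ)`. -/
def SProj {n : ℕ} (Φ : Eu n → ℝ) (k : ℤ) (f : Eu n → ℂ) (x : Eu n) : ℂ :=
  ((((2 * Real.pi) ^ n)⁻¹ : ℝ) : ℂ) *
    ∫ ξ, ((Φ ((2 : ℝ) ^ (-k) • ξ) : ℝ) : ℂ) * FT f ξ *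
      Complex.exp (Complex.I * ((⟪x, ξ⟫ : ℝ) : ℂ))

/-- The Littlewood–Paley piece `Δ_k f = S_k f - S_{k-1} f`, with Fourier multiplier
`Ψ(2^{-k}ξ) = Φ(2^{-k}ξ) - Φ(2^{-(k-1)}ξ)`. -/
def DProj {n : ℕ} (Φ : Eu n → ℝ) (k : ℤ) (f : Eu n → ℂ) (x : Eu n) : ℂ :=
  SProj Φ k f x - SProj Φ (k - 1) f x

open FourierTransform in
lemma L_id {n : ℕ} {A B : Eu n → ℂ} (hA : ContDiff ℝ (⊤ : ℕ∞) A) (hA' : HasCompactSupport A)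
    (hB : ContDiff ℝ (⊤ : ℕ∞) B) (hB' : HasCompactSupport B) (x ζ : Eu n) :
    𝓕⁻ (fun y => 𝓕⁻ A y * 𝓕⁻ B (x - y)) ζ =
      ∫ η, A η * (B (η + ζ) * Complex.exp (((2 * π * ⟪x, η + ζ⟫ : ℝ) : ℂ) * Complex.I)) := by
  set b : Eu n → ℂ := fun η => B η * Complex.exp (((2 * π * ⟪x, η⟫ : ℝ) : ℂ) * Complex.I) with hb
  have hbs : ContDiff ℝ (⊤ : ℕ∞) b := by
    apply hB.mul
    apply ContDiff.cexp
    apply ContDiff.mul _ contDiff_const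
    apply Complex.ofRealCLM.contDiff.comp
    exact contDiff_const.mul (contDiff_const.inner ℝ contDiff_id)
  have hbc : HasCompactSupport b := hB'.mul_right
  have hcs : ContDiff ℝ (⊤ : ℕ∞) (fun η => b (η + ζ)) :=
    hbs.comp (contDiff_id.add contDiff_const)
  have hcc : HasCompactSupport (fun η => b (η + ζ)) :=
    hbc.comp_homeomorph (Homeomorph.addRight ζ)
  let SA := hA'.toSchwartzMap hA
  let Sb := hcc.toSchwartzMap hcs
  have hSA : (⇑SA) = A := rfl
  have hSb : (⇑Sb) = (fun η => b (η + ζ)) := rfl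
  have key := SchwartzMap.integral_fourier_mul_eq Sb (𝓕⁻ SA)
  rw [FourierTransform.fourier_fourierInv_eq, SchwartzMap.fourierInv_coe, SchwartzMap.fourier_coe,
    hSA, hSb] at key
  have e1 : ∫ η, A η * (B (η + ζ) * Complex.exp (((2 * π * ⟪x, η + ζ⟫ : ℝ) : ℂ) * Complex.I))
      = ∫ η, b (η + ζ) * A η := by
    congr 1; ext η; simp only [hb]; ring
  rw [e1, ← key, Real.fourierInv_eq']
  congr 1; ext y
  rw [Real.fourier_eq']
  have : ∫ v, Complex.exp (((-2 * π * ⟪v, y⟫ : ℝ) : ℂ) * Complex.I) • b (v + ζ) =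
     ∫ v, Complex.exp (((-2 * π * ⟪v - ζ, y⟫ : ℝ) : ℂ) * Complex.I) • b v := by
    rw [← integral_add_right_eq_self (μ := volume)
      (fun v => Complex.exp (((-2 * π * ⟪v - ζ, y⟫ : ℝ) : ℂ) * Complex.I) • b v) ζ]
    simp
  rw [this, Real.fourierInv_eq' B, smul_eq_mul, mul_left_comm, mul_comm (∫ _, _)]
  congr 1
  rw [← integral_const_mul]
  congr 1; ext v
  simp only [hb, smul_eq_mul]
  rw [mul_comm (B v), ← mul_assoc, ← mul_assoc, ← Complex.exp_add, ← Complex.exp_add]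
  congr 2
  simp only [inner_sub_left, inner_sub_right]
  rw [real_inner_comm v x, real_inner_comm ζ y]
  push_cast; ring

open FourierTransform in
lemma L_inv_zero {n : ℕ} (F : Eu n → ℂ) : 𝓕⁻ F 0 = ∫ y, F y := by
  rw [Real.fourierInv_eq']; simp

open FourierTransform in
lemma L_schw {n : ℕ} {A : Eu n → ℂ} (hA : ContDiff ℝ (⊤ : ℕ∞) A) (hA' : HasCompactSupport A) :
    ∃ S : SchwartzMap (Eu n) ℂ, ⇑S = 𝓕⁻ A :=
  ⟨𝓕⁻ (hA'.toSchwartzMap hA), SchwartzMap.fourierInv_coe _⟩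

open FourierTransform in
lemma L_nik {n : ℕ} {A B : Eu n → ℂ} (hA : ContDiff ℝ (⊤ : ℕ∞) A) (hA' : HasCompactSupport A)
    (hB : ContDiff ℝ (⊤ : ℕ∞) B) (hB' : HasCompactSupport B) (r s : ℝ)
    (hAr : ∀ ξ, r ≤ ‖ξ‖ → A ξ = 0) (hBs : ∀ ξ, s ≤ ‖ξ‖ → B ξ = 0) (x y : Eu n) :
    ‖𝓕⁻ A y * 𝓕⁻ B (x - y)‖ₑ ≤ volume (Metric.closedBall (0 : Eu n) (r + s)) *
      ∫⁻ y, ‖𝓕⁻ A y * 𝓕⁻ B (x - y)‖ₑ := by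
  obtain ⟨SA, hSA⟩ := L_schw hA hA'
  obtain ⟨SB, hSB⟩ := L_schw hB hB'
  set F : Eu n → ℂ := fun y => 𝓕⁻ A y * 𝓕⁻ B (x - y) with hF
  have hcA : Continuous (𝓕⁻ A) := hSA ▸ SA.continuous
  have hcB : Continuous (𝓕⁻ B) := hSB ▸ SB.continuous
  have hFc : Continuous F := by fun_prop
  have hiA : Integrable (𝓕⁻ A) := hSA ▸ SA.integrable
  have hFi : Integrable F := by
    apply Integrable.mul_bdd (c := (SchwartzMap.seminorm ℝ 0 0) SB) hiA
    · exact (hcB.comp (by fun_prop)).aestronglyMeasurable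
    · filter_upwards with y
      rw [← hSB]; exact SB.norm_le_seminorm ℝ _
  have hG0 : ∀ ζ, ζ ∉ Metric.closedBall (0 : Eu n) (r + s) → 𝓕⁻ F ζ = 0 := by
    intro ζ hζ
    rw [hF, L_id hA hA' hB hB']
    apply integral_eq_zero_of_ae
    filter_upwards with η
    simp only [Metric.mem_closedBall, dist_zero_right, not_le] at hζ
    by_cases h1 : r ≤ ‖η‖
    · simp [hAr η h1]
    · have : s ≤ ‖η + ζ‖ := by
        have := norm_sub_le (η + ζ) η
        simp at this; linarith
      simp [hBs _ this]
  have hGb : ∀ ζ, ‖𝓕⁻ F ζ‖ₑ ≤ ∫⁻ y, ‖F y‖ₑ := by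
    intro ζ
    rw [Real.fourierInv_eq]
    refine (enorm_integral_le_lintegral_enorm _).trans (le_of_eq ?_)
    congr 1; ext y
    rw [← ofReal_norm, Circle.norm_smul, ofReal_norm]
  have hGc : Continuous (𝓕⁻ F) := by
    have : 𝓕⁻ F = fun w => 𝓕 F (-w) := by ext w; exact Real.fourierInv_eq_fourier_neg F w
    rw [this]
    have h2 : Continuous (𝓕 F) :=
      VectorFourier.fourierIntegral_continuous Real.continuous_fourierChar
        (by exact continuous_inner) hFi
    exact h2.comp continuous_neg
  have hGcs : HasCompactSupport (𝓕⁻ F) :=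
    HasCompactSupport.intro (isCompact_closedBall _ _) hG0
  have hGi : Integrable (𝓕⁻ F) := hGc.integrable_of_hasCompactSupport hGcs
  have hGi' : Integrable (𝓕 F) := by
    have : 𝓕 F = fun w => 𝓕⁻ F (-w) := by ext w; rw [Real.fourierInv_eq_fourier_neg, neg_neg]
    rw [this]; exact hGi.comp_neg
  have hinv := hFc.fourier_fourierInv_eq hFi hGi'
  change ‖F y‖ₑ ≤ _ * ∫⁻ y, ‖F y‖ₑ
  calc ‖F y‖ₑ = ‖𝓕 (𝓕⁻ F) y‖ₑ := by rw [hinv]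
    _ ≤ ∫⁻ ζ, ‖𝓕⁻ F ζ‖ₑ := by
      rw [Real.fourier_eq]
      refine (enorm_integral_le_lintegral_enorm _).trans (le_of_eq ?_)
      congr 1; ext y
      rw [← ofReal_norm, Circle.norm_smul, ofReal_norm]
    _ ≤ ∫⁻ ζ, (Metric.closedBall (0 : Eu n) (r + s)).indicator (fun _ => ∫⁻ y, ‖F y‖ₑ) ζ := by
      apply lintegral_mono
      intro ζ
      by_cases h : ζ ∈ Metric.closedBall (0 : Eu n) (r + s)
      · simpa [Set.indicator_of_mem h] using hGb ζ
      · simp [hG0 ζ h]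
    _ = _ := by
      rw [lintegral_indicator Metric.isClosed_closedBall.measurableSet, setLIntegral_const, mul_comm]

lemma L_jensen {n : ℕ} {K u : Eu n → ℝ≥0∞} (hK : Measurable K) (hu : Measurable u)
    {p : ℝ} (hp : 1 ≤ p) :
    (∫⁻ y, K y * u y) ^ p ≤ (∫⁻ y, K y) ^ (p - 1) * ∫⁻ y, K y * u y ^ p := by
  have hp0 : 0 < p := by linarith
  have h1 : 1 / p ≤ 1 := by rw [div_le_one hp0]; exact hp
  have h := ENNReal.lintegral_mul_norm_pow_le (μ := volume) hK.aemeasurable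
    (hK.mul (hu.pow_const p)).aemeasurable (p := 1 - 1 / p) (q := 1 / p)
    (by linarith) (by positivity) (by ring)
  have e : ∀ y, K y ^ (1 - 1 / p) * (K y * u y ^ p) ^ (1 / p) = K y * u y := by
    intro y
    rw [ENNReal.mul_rpow_of_nonneg _ _ (by positivity), ← mul_assoc, ← ENNReal.rpow_mul,
      mul_one_div_cancel hp0.ne', ENNReal.rpow_one]
    rw [← ENNReal.rpow_add_of_nonneg _ _ (by linarith) (by positivity)]
    simp
  simp only [Pi.mul_apply, e] at h
  calc (∫⁻ y, K y * u y) ^ p ≤ _ := ENNReal.rpow_le_rpow h hp0.le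
    _ = _ := by
      rw [ENNReal.mul_rpow_of_nonneg _ _ hp0.le, ← ENNReal.rpow_mul, ← ENNReal.rpow_mul,
        one_div_mul_cancel hp0.ne', ENNReal.rpow_one]
      congr 2
      field_simp

lemma L_nik2 {n : ℕ} {G : Eu n → ℝ≥0∞} (hG : Measurable G) {D : ℝ≥0∞}
    (hI : ∫⁻ y, G y ≠ ∞) (hGD : ∀ y, G y ≤ D * ∫⁻ y, G y)
    {p : ℝ} (hp0 : 0 < p) (hp : p < 1) :
    (∫⁻ y, G y) ^ p ≤ D ^ (1 - p) * ∫⁻ y, G y ^ p := by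
  set J := ∫⁻ y, G y with hJ
  by_cases h0 : J = 0
  · rw [h0, ENNReal.zero_rpow_of_pos hp0]; exact zero_le
  have hpos : 0 < 1 - p := by linarith
  have h1 : J ≤ (D * J) ^ (1 - p) * ∫⁻ y, G y ^ p := by
    rw [← lintegral_const_mul _ (hG.pow_const p)]
    rw [hJ]
    apply lintegral_mono
    intro y
    calc G y = G y ^ (1 - p) * G y ^ p := by
          rw [← ENNReal.rpow_add_of_nonneg _ _ hpos.le hp0.le]; simp
      _ ≤ _ := by
          exact mul_le_mul_left (ENNReal.rpow_le_rpow (hGD y) hpos.le) _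
  rw [ENNReal.mul_rpow_of_nonneg _ _ hpos.le] at h1
  have hne : J ^ (1 - p) ≠ 0 := by simp [ENNReal.rpow_eq_zero_iff, h0, hp.le]
  have hnt : J ^ (1 - p) ≠ ∞ := ENNReal.rpow_ne_top_of_nonneg hpos.le hI
  have h2 : J ^ (1 - p) * J ^ p ≤ J ^ (1 - p) * (D ^ (1 - p) * ∫⁻ y, G y ^ p) := by
    calc J ^ (1 - p) * J ^ p = J := by
          rw [← ENNReal.rpow_add_of_nonneg _ _ hpos.le hp0.le]; simp
      _ ≤ _ := h1
      _ = _ := by ring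
  exact (ENNReal.mul_le_mul_iff_right hne hnt).1 h2

lemma jweight_meas {n : ℕ} (a : ℝ) : Measurable (jweight (n := n) a) := by
  unfold jweight
  fun_prop

lemma jweight_one_le {n : ℕ} {a : ℝ} (ha : 0 ≤ a) (x : Eu n) : 1 ≤ jweight a x := by
  unfold jweight
  rw [ENNReal.one_le_ofReal]
  apply Real.one_le_rpow _ (by positivity)
  nlinarith [sq_nonneg ‖x‖]

lemma jweight_le {n : ℕ} {a : ℝ} (ha : 0 ≤ a) (x y : Eu n) :
    jweight a x ≤ ENNReal.ofReal (2 ^ (a / 2)) * (jweight a (x - y) * jweight a y) := by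
  unfold jweight
  rw [← ENNReal.ofReal_mul (by positivity), ← ENNReal.ofReal_mul (by positivity)]
  apply ENNReal.ofReal_le_ofReal
  rw [← Real.mul_rpow (by positivity) (by positivity), ← Real.mul_rpow (by positivity) (by positivity)]
  apply Real.rpow_le_rpow (by positivity) _ (by positivity)
  have h : ‖x‖ ≤ ‖x - y‖ + ‖y‖ := by simpa using norm_add_le (x - y) y
  nlinarith [sq_nonneg (‖x - y‖ - ‖y‖), sq_nonneg (‖x - y‖ * ‖y‖), norm_nonneg x,
    norm_nonneg y, norm_nonneg (x - y), sq_nonneg ‖x - y‖, sq_nonneg ‖y‖]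

lemma L_young {n : ℕ} {a : ℝ} (ha : 0 ≤ a) {T u W : Eu n → ℝ≥0∞} (hu : Measurable u)
    (hW : Measurable W) (D E : ℝ≥0∞)
    (hT : ∀ x, T x ≤ D * ∫⁻ y, W y * u (x - y)) (hE : ∫⁻ y, W y * jweight a y ≤ E) :
    ∫⁻ x, T x * jweight a x ≤ D * (ENNReal.ofReal (2 ^ (a / 2)) * E) * ∫⁻ x, u x * jweight a x := by
  have hj := jweight_meas (n := n) a
  set c := ENNReal.ofReal (2 ^ (a / 2)) with hc
  calc ∫⁻ x, T x * jweight a x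
      ≤ ∫⁻ x, ∫⁻ y, D * c * ((W y * jweight a y) * (u (x - y) * jweight a (x - y))) := by
        apply lintegral_mono
        intro x
        calc T x * jweight a x ≤ (D * ∫⁻ y, W y * u (x - y)) * jweight a x := by
              gcongr; exact hT x
          _ = ∫⁻ y, D * (W y * u (x - y)) * jweight a x := by
              rw [lintegral_mul_const, lintegral_const_mul] <;> fun_prop
          _ ≤ _ := by
              apply lintegral_mono
              intro y
              calc D * (W y * u (x - y)) * jweight a x
                  ≤ D * (W y * u (x - y)) * (c * (jweight a (x - y) * jweight a y)) := by
                    gcongr; exact jweight_le ha x y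
                _ = _ := by ring
    _ = ∫⁻ y, ∫⁻ x, D * c * ((W y * jweight a y) * (u (x - y) * jweight a (x - y))) := by
        apply lintegral_lintegral_swap
        apply Measurable.aemeasurable
        unfold Function.uncurry
        fun_prop
    _ = ∫⁻ y, D * c * (W y * jweight a y) * ∫⁻ x, u x * jweight a x := by
        congr 1; ext y
        rw [← lintegral_sub_right_eq_self (fun x => u x * jweight a x) y, ← lintegral_const_mul]
        · simp only [mul_assoc]
        · fun_prop
    _ = D * c * (∫⁻ y, W y * jweight a y) * ∫⁻ x, u x * jweight a x := by
        rw [lintegral_mul_const, lintegral_const_mul] <;> fun_prop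
    _ ≤ _ := by
        rw [mul_assoc D c]
        gcongr

lemma L_exp (b c : ℝ) (hb : 0 ≤ b) (hc : 0 < c) :
    ∃ C : ℝ, 0 < C ∧ ∀ t : ℝ, 0 ≤ t → Real.exp (-c * t) ≤ C * (1 + t ^ 2) ^ (-b) := by
  obtain ⟨m, hm⟩ := exists_nat_ge (2 * b)
  refine ⟨m.factorial / c ^ m * Real.exp c, by positivity, fun t ht => ?_⟩
  have h1 : (1 + t ^ 2) ^ b ≤ (1 + t) ^ m := by
    calc (1 + t ^ 2) ^ b ≤ ((1 + t) ^ (2 : ℕ)) ^ b := by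
          apply Real.rpow_le_rpow (by positivity) _ hb
          nlinarith
      _ = (1 + t) ^ (2 * b) := by
          rw [← Real.rpow_natCast, ← Real.rpow_mul (by positivity)]; norm_num
      _ ≤ (1 + t) ^ (m : ℝ) := Real.rpow_le_rpow_of_exponent_le (by linarith) hm
      _ = _ := Real.rpow_natCast _ _
  have h2 := Real.pow_div_factorial_le_exp (c * (1 + t)) (by positivity) m
  rw [div_le_iff₀ (by positivity), mul_pow] at h2
  rw [Real.rpow_neg (by positivity), ← div_eq_mul_inv, le_div_iff₀ (by positivity)]
  have h3 : (1 + t) ^ m ≤ m.factorial / c ^ m * Real.exp (c * (1 + t)) := by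
    rw [div_mul_eq_mul_div, le_div_iff₀ (by positivity)]; linarith
  calc Real.exp (-c * t) * (1 + t ^ 2) ^ b
      ≤ Real.exp (-c * t) * (m.factorial / c ^ m * Real.exp (c * (1 + t))) := by
        gcongr; exact h1.trans h3
    _ = m.factorial / c ^ m * (Real.exp (-c * t) * Real.exp (c * (1 + t))) := by ring
    _ = _ := by rw [← Real.exp_add]; congr 2; ring

lemma L_scale {n : ℕ} (f : Eu n → ℝ≥0∞) (hf : Measurable f) (r : ℝ) (hr : 0 < r) :
    ENNReal.ofReal (r ^ n) * ∫⁻ y, f (r • y) = ∫⁻ y, f y := by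
  rw [← lintegral_map (f := f) (g := fun y => r • y) hf (by fun_prop),
    Measure.map_addHaar_smul _ hr.ne', lintegral_smul_measure, smul_eq_mul, ← mul_assoc,
    ← ENNReal.ofReal_mul (by positivity)]
  rw [finrank_euclideanSpace_fin, abs_of_pos (by positivity), mul_inv_cancel₀ (by positivity)]
  simp

open FourierTransform in
lemma L_K {n : ℕ} (s : Eu n → ℂ) (r : ℝ) (hr : 0 < r) (y : Eu n) :
    ‖𝓕⁻ (fun η => s ((r⁻¹ * (2 * π)) • η)) y‖ ≤ r ^ n * ‖FT s (-(r • y))‖ := by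
  have h0 : 0 < r⁻¹ * (2 * π) := by positivity
  have h := Measure.integral_comp_smul (volume : Measure (Eu n))
    (fun ζ => s ζ * Complex.exp (-(Complex.I * ((⟪ζ, -(r • y)⟫ : ℝ) : ℂ)))) (r⁻¹ * (2 * π))
  have e : 𝓕⁻ (fun η => s ((r⁻¹ * (2 * π)) • η)) y =
     |((r⁻¹ * (2 * π)) ^ n)⁻¹| • FT s (-(r • y)) := by
    rw [finrank_euclideanSpace_fin] at h
    unfold FT
    rw [← h, Real.fourierInv_eq']
    congr 1; ext η
    rw [smul_eq_mul, mul_comm]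
    congr 2
    rw [inner_neg_right, inner_smul_left, inner_smul_right]
    simp only [conj_trivial]
    have : r⁻¹ * (2 * π) * (r * ⟪η, y⟫) = 2 * π * ⟪η, y⟫ := by field_simp
    rw [this]; push_cast; ring
  rw [e, norm_smul, Real.norm_eq_abs, abs_abs, abs_of_pos (by positivity)]
  gcongr
  rw [← inv_pow]
  gcongr
  rw [mul_inv, inv_inv]
  apply mul_le_of_le_one_right hr.le
  apply inv_le_one_of_one_le₀
  nlinarith [Real.pi_gt_three]

open FourierTransform in
lemma L_kernel {n : ℕ} (a : ℝ) (ha : 0 ≤ a) (σ : ℕ → Eu n → ℂ)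
    (γ : ℝ) (hγ0 : 0 < γ) (q : ℝ) (hq : 0 < q) (hγ : (n : ℝ) < γ * q) (c : ℝ) (hc : 0 < c)
    (hdecay : ∀ M : ℝ, 0 < M → ∃ CM : ℝ, 0 < CM ∧ ∀ k : ℕ, ∀ x : Eu n,
      ‖FT (σ k) x‖ ≤ CM * ((1 + ‖x‖ ^ 2) ^ (-M / 2) +
        (1 + ‖x‖ ^ 2) ^ (-γ / 2) * Real.exp (-c * 2 ^ (-(k : ℝ)) * ‖x‖))) :
    ∃ E : ℝ≥0∞, E ≠ ∞ ∧ ∀ k : ℕ,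
      ∫⁻ y, (ENNReal.ofReal (((2 : ℝ) ^ k) ^ (n : ℕ)) ^ (1 - q) *
        ‖𝓕⁻ (fun η => σ k ((((2 : ℝ) ^ k)⁻¹ * (2 * π)) • η)) y‖ₑ ^ q) * jweight a y ≤ E := by
  obtain ⟨CM, hCM, hd⟩ := hdecay (γ + a / q) (by positivity)
  obtain ⟨C', hC', he⟩ := L_exp (a / (2 * q)) c (by positivity) hc
  set C1 := (CM * (1 + C')) ^ q with hC1
  have hint := integrable_rpow_neg_one_add_norm_sq (E := Eu n) (μ := volume) (r := γ * q)
    (by rw [finrank_euclideanSpace_fin]; exact hγ)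
  set f : Eu n → ℝ≥0∞ := fun y => ENNReal.ofReal ((1 + ‖y‖ ^ 2) ^ (-(γ * q) / 2)) with hf
  have hfm : Measurable f := by rw [hf]; fun_prop
  refine ⟨ENNReal.ofReal C1 * ∫⁻ y, f y, ?_, fun k => ?_⟩
  · apply ENNReal.mul_ne_top ENNReal.ofReal_ne_top
    exact hint.lintegral_lt_top.ne
  set ρ : ℝ := 2 ^ k with hρ
  have hρ1 : 1 ≤ ρ := one_le_pow₀ (by norm_num)
  have hρ0 : 0 < ρ := by linarith
  rw [← L_scale f hfm ρ hρ0, ← lintegral_const_mul _ (by fun_prop), ← lintegral_const_mul _ (by fun_prop)]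
  apply lintegral_mono
  intro y
  have hK := L_K (σ k) ρ hρ0 y
  set X := 1 + ‖ρ • y‖ ^ 2 with hX
  set Y := 1 + ‖y‖ ^ 2 with hY
  have hY1 : 1 ≤ Y := by nlinarith [sq_nonneg ‖y‖]
  have hYX : Y ≤ X := by
    rw [hX, hY, norm_smul, Real.norm_of_nonneg hρ0.le]
    gcongr
    nlinarith [norm_nonneg y]
  have hX0 : 0 < X := by linarith
  have hY0 : 0 < Y := by linarith
  have hF : ‖FT (σ k) (-(ρ • y))‖ ≤ CM * (1 + C') * (X ^ (-γ / 2) * Y ^ (-(a / (2 * q)))) := by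
    refine (hd k _).trans ?_
    rw [norm_neg, ← hX]
    have e1 : -c * 2 ^ (-(k : ℝ)) * ‖ρ • y‖ = -c * ‖y‖ := by
      rw [norm_smul, Real.norm_of_nonneg hρ0.le, Real.rpow_neg (by norm_num), Real.rpow_natCast,
        ← hρ]
      field_simp
    rw [e1]
    have e2 : X ^ (-(γ + a / q) / 2) ≤ X ^ (-γ / 2) * Y ^ (-(a / (2 * q))) := by
      have : -(γ + a / q) / 2 = -γ / 2 + -(a / (2 * q)) := by field_simp; ring
      rw [this, Real.rpow_add hX0]
      apply mul_le_mul_of_nonneg_left _ (by positivity)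
      apply Real.rpow_le_rpow_of_nonpos hY0 hYX
      have : 0 ≤ a / (2 * q) := by positivity
      linarith
    have e3 := he ‖y‖ (norm_nonneg y)
    rw [← hY] at e3
    calc _ ≤ CM * (X ^ (-γ / 2) * Y ^ (-(a / (2 * q))) +
          X ^ (-γ / 2) * (C' * Y ^ (-(a / (2 * q))))) := by gcongr
      _ = _ := by ring
  have hK2 : ‖𝓕⁻ (fun η => σ k ((ρ⁻¹ * (2 * π)) • η)) y‖ ≤
      ρ ^ n * (CM * (1 + C') * (X ^ (-γ / 2) * Y ^ (-(a / (2 * q))))) :=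
    hK.trans (by gcongr)
  set Kv := ‖𝓕⁻ (fun η => σ k ((ρ⁻¹ * (2 * π)) • η)) y‖ with hKv
  have hKv0 : 0 ≤ Kv := norm_nonneg _
  have hfin : (ρ ^ n) ^ (1 - q) * Kv ^ q * Y ^ (a / 2) ≤ C1 * (ρ ^ n * X ^ (-(γ * q) / 2)) := by
    calc (ρ ^ n) ^ (1 - q) * Kv ^ q * Y ^ (a / 2)
        ≤ (ρ ^ n) ^ (1 - q) * (ρ ^ n * (CM * (1 + C') * (X ^ (-γ / 2) * Y ^ (-(a / (2 * q)))))) ^ q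
            * Y ^ (a / 2) := by gcongr
      _ = C1 * (((ρ ^ n) ^ (1 - q) * (ρ ^ n) ^ q) * (X ^ (-γ / 2)) ^ q *
            ((Y ^ (-(a / (2 * q)))) ^ q * Y ^ (a / 2))) := by
          rw [Real.mul_rpow (x := ρ ^ n) (by positivity) (by positivity),
            Real.mul_rpow (x := CM * (1 + C')) (by positivity) (by positivity),
            Real.mul_rpow (x := X ^ (-γ / 2)) (by positivity) (by positivity), ← hC1]
          ring
      _ = _ := by
          rw [← Real.rpow_add (by positivity), ← Real.rpow_mul hX0.le, ← Real.rpow_mul hY0.le,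
            ← Real.rpow_add hY0]
          have h1 : -(a / (2 * q)) * q + a / 2 = 0 := by field_simp; ring
          have h2 : 1 - q + q = 1 := by ring
          have h3 : -γ / 2 * q = -(γ * q) / 2 := by ring
          rw [h1, h2, h3, Real.rpow_zero, Real.rpow_one, mul_one]
  have := ENNReal.ofReal_le_ofReal hfin
  rw [ENNReal.ofReal_mul (by positivity), ENNReal.ofReal_mul (by positivity),
    ENNReal.ofReal_mul (by positivity), ENNReal.ofReal_mul (by positivity),
    ← ENNReal.ofReal_rpow_of_pos (by positivity), ← ENNReal.ofReal_rpow_of_nonneg hKv0 hq.le,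
    hKv, ofReal_norm] at this
  exact this

open FourierTransform in
lemma L_cov {n : ℕ} (g h : Eu n → ℂ) (x : Eu n) :
    ((((2 * Real.pi) ^ n)⁻¹ : ℝ) : ℂ) *
      ∫ ξ, g ξ * FT h ξ * Complex.exp (Complex.I * ((⟪x, ξ⟫ : ℝ) : ℂ)) =
    𝓕⁻ (fun η => g ((2 * π) • η) * 𝓕 h η) x := by
  have h0 := Measure.integral_comp_smul (volume : Measure (Eu n))
    (fun ξ => g ξ * FT h ξ * Complex.exp (Complex.I * ((⟪x, ξ⟫ : ℝ) : ℂ))) (2 * π)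
  rw [finrank_euclideanSpace_fin, abs_of_pos (by positivity), Complex.real_smul] at h0
  rw [← h0, Real.fourierInv_eq']
  congr 1; ext η
  have e : FT h ((2 * π) • η) = 𝓕 h η := by
    unfold FT
    rw [Real.fourier_eq']
    congr 1; ext y
    rw [smul_eq_mul, mul_comm, inner_smul_right]
    congr 2; push_cast; ring
  rw [e, smul_eq_mul, mul_comm, inner_smul_right, real_inner_comm]
  congr 2; push_cast; ring

lemma L_cs {n : ℕ} {A : Eu n → ℂ} (r : ℝ) (h : ∀ ξ, r ≤ ‖ξ‖ → A ξ = 0) : HasCompactSupport A := by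
  apply HasCompactSupport.intro (isCompact_closedBall (0 : Eu n) r)
  intro x hx
  apply h
  simp at hx
  exact hx.le

open FourierTransform in
lemma L_repr {n : ℕ} (s : Eu n → ℂ) (hs : ContDiff ℝ (⊤ : ℕ∞) s)
    (R : ℝ) (hsupp : tsupport s ⊆ Metric.ball (0 : Eu n) R)
    (Φ : Eu n → ℝ) (hΦ : IsLPBump Φ) (k : ℕ) (h : SchwartzMap (Eu n) ℂ) :
    let A : Eu n → ℂ := fun η => s ((((2 : ℝ) ^ k)⁻¹ * (2 * π)) • η)
    ∃ B : Eu n → ℂ, ContDiff ℝ (⊤ : ℕ∞) A ∧ (∀ ξ, 2 ^ k * R ≤ ‖ξ‖ → A ξ = 0) ∧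
      ContDiff ℝ (⊤ : ℕ∞) B ∧ (∀ ξ, 2 ^ k * 2 ≤ ‖ξ‖ → B ξ = 0) ∧
      SProj Φ (k : ℤ) ⇑h = 𝓕⁻ B ∧
      (fun x => ((((2 * Real.pi) ^ n)⁻¹ : ℝ) : ℂ) *
          ∫ ξ, s ((2 : ℝ) ^ (-(k : ℤ)) • ξ) * ((Φ ((2 : ℝ) ^ (-(k : ℤ)) • ξ) : ℝ) : ℂ) *
            FT ⇑h ξ * Complex.exp (Complex.I * ((⟪x, ξ⟫ : ℝ) : ℂ))) =
        fun x => ∫ y, 𝓕⁻ A y * 𝓕⁻ B (x - y) := by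
  intro A
  set ρ : ℝ := 2 ^ k with hρ
  have hρ0 : 0 < ρ := by positivity
  have hz : (2 : ℝ) ^ (-(k : ℤ)) = ρ⁻¹ := by rw [zpow_neg, zpow_natCast]
  have hnorm : ∀ (t : ℝ) (ξ : Eu n), 0 ≤ t → ρ * t ≤ ‖ξ‖ → t ≤ ‖(ρ⁻¹ * (2 * π)) • ξ‖ := by
    intro t ξ ht h
    rw [norm_smul, Real.norm_of_nonneg (by positivity)]
    have h1 : t ≤ ρ⁻¹ * ‖ξ‖ := by rw [le_inv_mul_iff₀ hρ0]; exact h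
    have : 0 ≤ ρ⁻¹ * ‖ξ‖ := by positivity
    nlinarith [Real.pi_gt_three]
  let B : Eu n → ℂ := fun η => ((Φ ((2 : ℝ) ^ (-(k : ℤ)) • (2 * π) • η) : ℝ) : ℂ) * 𝓕 ⇑h η
  have hA1 : ContDiff ℝ (⊤ : ℕ∞) A := hs.comp (contDiff_const_smul _)
  have hA2 : ∀ ξ, ρ * R ≤ ‖ξ‖ → A ξ = 0 := by
    intro ξ hξ
    by_contra hne
    have : (ρ⁻¹ * (2 * π)) • ξ ∈ Metric.ball (0 : Eu n) R :=
      hsupp (subset_tsupport _ (by simpa using hne))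
    rw [mem_ball_zero_iff] at this
    exact absurd (hnorm R ξ ((norm_nonneg _).trans this.le) hξ) (not_le.2 this)
  have hB1 : ContDiff ℝ (⊤ : ℕ∞) B := by
    apply ContDiff.mul
    · apply Complex.ofRealCLM.contDiff.comp
      exact hΦ.1.comp ((contDiff_const_smul _).comp (contDiff_const_smul _))
    · rw [← SchwartzMap.fourier_coe]; exact (𝓕 h).smooth _
  have hB2 : ∀ ξ, ρ * 2 ≤ ‖ξ‖ → B ξ = 0 := by
    intro ξ hξ
    simp only [B]
    rw [hz, smul_smul, hΦ.2.2.2 _ (hnorm 2 ξ (by norm_num) hξ)]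
    simp
  refine ⟨B, hA1, hA2, hB1, hB2, ?_, ?_⟩
  · ext x
    unfold SProj
    exact L_cov (fun ξ => ((Φ ((2 : ℝ) ^ (-(k : ℤ)) • ξ) : ℝ) : ℂ)) _ x
  · ext x
    rw [L_cov (fun ξ => s ((2 : ℝ) ^ (-(k : ℤ)) • ξ) * ((Φ ((2 : ℝ) ^ (-(k : ℤ)) • ξ) : ℝ) : ℂ)),
      ← L_inv_zero, L_id hA1 (L_cs _ hA2) hB1 (L_cs _ hB2), Real.fourierInv_eq']
    congr 1; ext η
    simp only [A, B, add_zero, smul_eq_mul, hz, smul_smul]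
    rw [real_inner_comm]; ring

lemma wNorm_le {n : ℕ} {p : ℝ≥0∞} (hp : 0 < p) (hpt : p ≠ ∞) (a : ℝ) (f g : Eu n → ℂ) (D : ℝ≥0∞)
    (h : ∫⁻ x, ‖f x‖ₑ ^ p.toReal * jweight a x ≤ D * ∫⁻ x, ‖g x‖ₑ ^ p.toReal * jweight a x) :
    wNorm p a f ≤ D ^ (1 / p.toReal) * wNorm p a g := by
  have h0 : 0 < p.toReal := ENNReal.toReal_pos hp.ne' hpt
  unfold wNorm
  rw [if_neg hpt, if_neg hpt, ← ENNReal.mul_rpow_of_nonneg _ _ (by positivity)]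
  exact ENNReal.rpow_le_rpow h (by positivity)

/-- **Key multiplier lemma** (Lemma 3.6). -/
theorem key_multiplier_lemma (n : ℕ) (hn : 1 ≤ n) (p : ℝ≥0∞) (hp : 0 < p)
    (a : ℝ) (ha : 0 ≤ a) (σ : ℕ → Eu n → ℂ) (hσ : ∀ k, ContDiff ℝ (⊤ : ℕ∞) (σ k))
    (R : ℝ) (hR : 0 < R) (hsupp : ∀ k, tsupport (σ k) ⊆ Metric.ball (0 : Eu n) R)
    (γ : ℝ) (hγ : max ((n : ℝ) / p.toReal) (n : ℝ) < γ) (c : ℝ) (hc : 0 < c)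
    (hdecay : ∀ M : ℝ, 0 < M → ∃ CM : ℝ, 0 < CM ∧ ∀ k : ℕ, ∀ x : Eu n,
      ‖FT (σ k) x‖ ≤ CM * ((1 + ‖x‖ ^ 2) ^ (-M / 2) +
        (1 + ‖x‖ ^ 2) ^ (-γ / 2) * Real.exp (-c * 2 ^ (-(k : ℝ)) * ‖x‖)))
    (Φ : Eu n → ℝ) (hΦ : IsLPBump Φ) :
    ∃ C : ℝ, 0 < C ∧ ∀ k : ℕ, ∀ h : SchwartzMap (Eu n) ℂ,
      wNorm p a (fun x => ((((2 * Real.pi) ^ n)⁻¹ : ℝ) : ℂ) *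
          ∫ ξ, σ k ((2 : ℝ) ^ (-(k : ℤ)) • ξ) * ((Φ ((2 : ℝ) ^ (-(k : ℤ)) • ξ) : ℝ) : ℂ) *
            FT ⇑h ξ * Complex.exp (Complex.I * ((⟪x, ξ⟫ : ℝ) : ℂ))) ≤
        ENNReal.ofReal C * wNorm p a (SProj Φ (k : ℤ) ⇑h) := by
  have hγn : (n : ℝ) < γ := (le_max_right _ _).trans_lt hγ
  have hγ0 : 0 < γ := (Nat.cast_nonneg n).trans_lt hγn
  -- it suffices to find an `ℝ≥0∞` constant
  suffices H : ∃ D : ℝ≥0∞, D ≠ ∞ ∧ ∀ k : ℕ, ∀ h : SchwartzMap (Eu n) ℂ,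
      wNorm p a (fun x => ((((2 * Real.pi) ^ n)⁻¹ : ℝ) : ℂ) *
          ∫ ξ, σ k ((2 : ℝ) ^ (-(k : ℤ)) • ξ) * ((Φ ((2 : ℝ) ^ (-(k : ℤ)) • ξ) : ℝ) : ℂ) *
            FT ⇑h ξ * Complex.exp (Complex.I * ((⟪x, ξ⟫ : ℝ) : ℂ))) ≤
        D * wNorm p a (SProj Φ (k : ℤ) ⇑h) by
    obtain ⟨D, hD, H⟩ := H
    refine ⟨D.toReal + 1, by positivity, fun k h => (H k h).trans ?_⟩
    gcongr
    rw [← ENNReal.toReal_le_toReal hD ENNReal.ofReal_ne_top, ENNReal.toReal_ofReal (by positivity)]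
    linarith
  -- uniform L¹ bound
  obtain ⟨E1, hE1, hk1⟩ := L_kernel a ha σ γ hγ0 1 one_pos (by simpa using hγn) c hc hdecay
  have hk1' : ∀ k : ℕ, ∫⁻ y, ‖FourierTransformInv.fourierInv
      (fun η => σ k ((((2 : ℝ) ^ k)⁻¹ * (2 * π)) • η)) y‖ₑ * jweight a y ≤ E1 := by
    intro k; simpa using hk1 k
  have hk1'' : ∀ k : ℕ, ∫⁻ y, ‖FourierTransformInv.fourierInv
      (fun η => σ k ((((2 : ℝ) ^ k)⁻¹ * (2 * π)) • η)) y‖ₑ ≤ E1 := by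
    intro k
    refine (lintegral_mono fun y => ?_).trans (hk1' k)
    exact le_mul_of_one_le_right zero_le (jweight_one_le ha y)
  by_cases hpt : p = ∞
  · refine ⟨E1, hE1, fun k h => ?_⟩
    obtain ⟨B, hA1, hA2, hB1, hB2, e1, e2⟩ := L_repr (σ k) (hσ k) R (hsupp k) Φ hΦ k h
    rw [e1, e2]
    unfold wNorm
    rw [if_pos hpt, if_pos hpt]
    set u := FourierTransformInv.fourierInv B with hu
    set K := FourierTransformInv.fourierInv (fun η => σ k ((((2 : ℝ) ^ k)⁻¹ * (2 * π)) • η)) with hK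
    have hes := ENNReal.ae_le_essSup (μ := volume) (fun x => ‖u x‖ₑ)
    refine essSup_le_of_ae_le _ ?_ (by isBoundedDefault)
    filter_upwards with x
    have hes2 : ∀ᵐ y, ‖u (x - y)‖ₑ ≤ essSup (fun x => ‖u x‖ₑ) volume :=
      (Measure.measurePreserving_sub_left volume x).quasiMeasurePreserving.ae hes
    calc ‖∫ y, K y * u (x - y)‖ₑ ≤ ∫⁻ y, ‖K y * u (x - y)‖ₑ := enorm_integral_le_lintegral_enorm _
      _ ≤ ∫⁻ y, ‖K y‖ₑ * essSup (fun x => ‖u x‖ₑ) volume := by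
          apply lintegral_mono_ae
          filter_upwards [hes2] with y hy
          rw [enorm_mul]
          gcongr
      _ = (∫⁻ y, ‖K y‖ₑ) * essSup (fun x => ‖u x‖ₑ) volume := by
          obtain ⟨SA, hSA⟩ := L_schw hA1 (L_cs _ hA2)
          rw [lintegral_mul_const]
          have : Continuous K := by rw [hK, ← hSA]; exact SA.continuous
          fun_prop
      _ ≤ E1 * essSup (fun x => ‖u x‖ₑ) volume := by
          gcongr
          exact hk1'' k
  have hp0 : 0 < p.toReal := ENNReal.toReal_pos hp.ne' hpt
  by_cases hp1 : 1 ≤ p.toReal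
  · refine ⟨(E1 ^ (p.toReal - 1) * (ENNReal.ofReal (2 ^ (a / 2)) * E1)) ^ (1 / p.toReal), ?_,
      fun k h => ?_⟩
    · apply ENNReal.rpow_ne_top_of_nonneg (by positivity)
      exact ENNReal.mul_ne_top (ENNReal.rpow_ne_top_of_nonneg (by linarith) hE1)
        (ENNReal.mul_ne_top ENNReal.ofReal_ne_top hE1)
    obtain ⟨B, hA1, hA2, hB1, hB2, e1, e2⟩ := L_repr (σ k) (hσ k) R (hsupp k) Φ hΦ k h
    rw [e1, e2]
    apply wNorm_le hp hpt
    obtain ⟨SA, hSA⟩ := L_schw hA1 (L_cs _ hA2)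
    obtain ⟨SB, hSB⟩ := L_schw hB1 (L_cs _ hB2)
    have hk := hk1' k
    have hkk := hk1'' k
    rw [← hSA] at hk hkk
    rw [← hSA, ← hSB]
    have hcA := SA.continuous
    have hcB := SB.continuous
    apply L_young ha (T := fun x => ‖∫ y, SA y * SB (x - y)‖ₑ ^ p.toReal)
      (u := fun x => ‖SB x‖ₑ ^ p.toReal) (W := fun y => ‖SA y‖ₑ) (by fun_prop) (by fun_prop)
      _ _ _ hk
    intro x
    calc ‖∫ y, SA y * SB (x - y)‖ₑ ^ p.toReal
        ≤ (∫⁻ y, ‖SA y‖ₑ * ‖SB (x - y)‖ₑ) ^ p.toReal := by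
          gcongr
          refine (enorm_integral_le_lintegral_enorm _).trans (le_of_eq ?_)
          simp only [enorm_mul]
      _ ≤ _ := L_jensen (by fun_prop) (hcB.comp (by fun_prop)).enorm.measurable hp1
      _ ≤ _ := by
          exact mul_le_mul_left (ENNReal.rpow_le_rpow hkk (by linarith)) _
  · push Not at hp1
    have hγp : (n : ℝ) < γ * p.toReal := by
      rw [← div_lt_iff₀ hp0]; exact (le_max_left _ _).trans_lt hγ
    obtain ⟨E, hE, hkE⟩ := L_kernel a ha σ γ hγ0 p.toReal hp0 hγp c hc hdecay
    set V : ℝ≥0∞ := ENNReal.ofReal ((R + 2) ^ n) * volume (Metric.ball (0 : Eu n) 1) with hV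
    have hVt : V ≠ ∞ := ENNReal.mul_ne_top ENNReal.ofReal_ne_top measure_ball_lt_top.ne
    refine ⟨(V ^ (1 - p.toReal) * (ENNReal.ofReal (2 ^ (a / 2)) * E)) ^ (1 / p.toReal), ?_,
      fun k h => ?_⟩
    · apply ENNReal.rpow_ne_top_of_nonneg (by positivity)
      exact ENNReal.mul_ne_top (ENNReal.rpow_ne_top_of_nonneg (by linarith) hVt)
        (ENNReal.mul_ne_top ENNReal.ofReal_ne_top hE)
    obtain ⟨B, hA1, hA2, hB1, hB2, e1, e2⟩ := L_repr (σ k) (hσ k) R (hsupp k) Φ hΦ k h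
    rw [e1, e2]
    apply wNorm_le hp hpt
    obtain ⟨SA, hSA⟩ := L_schw hA1 (L_cs _ hA2)
    obtain ⟨SB, hSB⟩ := L_schw hB1 (L_cs _ hB2)
    have hk := hkE k
    have hnik := L_nik hA1 (L_cs _ hA2) hB1 (L_cs _ hB2) _ _ hA2 hB2
    rw [← hSA] at hk
    rw [← hSA, ← hSB] at hnik
    rw [← hSA, ← hSB]
    have hcA := SA.continuous
    have hcB := SB.continuous
    set L : ℝ≥0∞ := ENNReal.ofReal (((2 : ℝ) ^ k) ^ n) with hL
    have hvol : volume (Metric.closedBall (0 : Eu n) (2 ^ k * R + 2 ^ k * 2)) = V * L := by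
      rw [Measure.addHaar_closedBall _ _ (by positivity), finrank_euclideanSpace_fin, ← mul_add,
        mul_pow, ENNReal.ofReal_mul (by positivity), hV, hL]
      ring
    apply L_young ha (T := fun x => ‖∫ y, SA y * SB (x - y)‖ₑ ^ p.toReal)
      (u := fun x => ‖SB x‖ₑ ^ p.toReal) (W := fun y => L ^ (1 - p.toReal) * ‖SA y‖ₑ ^ p.toReal)
      (by fun_prop) (by fun_prop) _ _ _ hk
    intro x
    have hFi : Integrable (fun y => SA y * SB (x - y)) := by
      apply Integrable.mul_bdd (c := (SchwartzMap.seminorm ℝ 0 0) SB) SA.integrable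
      · exact (hcB.comp (by fun_prop)).aestronglyMeasurable
      · filter_upwards with y
        exact SB.norm_le_seminorm ℝ _
    calc ‖∫ y, SA y * SB (x - y)‖ₑ ^ p.toReal
        ≤ (∫⁻ y, ‖SA y * SB (x - y)‖ₑ) ^ p.toReal := by
          gcongr
          exact enorm_integral_le_lintegral_enorm _
      _ ≤ (V * L) ^ (1 - p.toReal) * ∫⁻ y, ‖SA y * SB (x - y)‖ₑ ^ p.toReal := by
          apply L_nik2 (by fun_prop) hFi.2.ne _ hp0 hp1
          intro y
          rw [← hvol]
          exact hnik x y
      _ = _ := by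
          rw [ENNReal.mul_rpow_of_nonneg _ _ (by linarith), mul_assoc,
            ← lintegral_const_mul _ (by fun_prop)]
          congr 2; ext y
          rw [enorm_mul, ENNReal.mul_rpow_of_nonneg _ _ hp0.le, mul_assoc]
end
end

section
/- (Key commutator multiplier lemma) Let n ≥ 1, p ∈ [1/2,∞], p₁,p₂ ∈ [1,∞], and a,a₁,a₂ ≥ 0 satisfy 1/p = 1/p₁ + 1/p₂ and a/p = a₁/p₁ + a₂/p₂. Let {σ_k}_{k∈ℕ} be a family of C^∞ functions on ℝⁿ with supp σ_k ⊆ {|ξ| < R} for some R > 0 and all k, and suppose there exist γ > max{n/p, n} and c > 0 such that for every M > 0 there is C_M with |σ̂_k(x)| ≤ C_M ( ⟨x⟩^{−M} + ⟨x⟩^{−γ} e^{−c 2^{−k} |x|} ) for all k ∈ ℕ and x ∈ ℝⁿ. Then there exists C > 0 such that for every k ∈ ℕ and all f, g ∈ 𝒮(ℝⁿ): ‖ (2π)^{−2n} ∫_0^1 ∫_{ℝⁿ} ∫_{ℝⁿ} σ_k(2^{−k}(tξ+η)) Φ(2^{−(k−3)}ξ) f̂(ξ) Ψ(2^{−k}η)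 ĝ(η) e^{i(ξ+η)·x} dξ dη dt ‖_{L^p_{⟨x⟩^a}} ≤ C ‖S_{k−3} f‖_{L^{p₁}_{⟨x⟩^{a₁}}} ‖Δ_k g‖_{L^{p₂}_{⟨x⟩^{a₂}}}. -/
open MeasureTheory Real Complex
open scoped ENNReal NNReal RealInnerProductSpace

noncomputable section

/-- lattice points `L m` -/
def qv {n : ℕ} (L : ℝ) (m : Fin n → ℤ) : Eu n := WithLp.toLp 2 (fun i => L * (m i : ℝ))

/-- section of the torus -/
def tsec {n : ℕ} (P : ℝ) (x : UnitAddTorus (Fin n)) : Eu n :=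
  WithLp.toLp 2 (fun i => P * ((AddCircle.equivIco (1:ℝ) (-(1/2)) (x i)).1 : ℝ))

lemma abs_equivIco (y : AddCircle (1:ℝ)) :
    |((AddCircle.equivIco (1:ℝ) (-(1/2)) y).1 : ℝ)| = ‖y‖ := by
  have h := (AddCircle.equivIco (1:ℝ) (-(1/2)) y).2
  conv_rhs => rw [← AddCircle.coe_equivIco (p := (1:ℝ)) (a := -(1/2)) (y := y)]
  symm
  rw [AddCircle.norm_coe_eq_abs_iff _ one_ne_zero]
  rw [abs_le]
  simp only [Set.mem_Ico] at h
  norm_num at h ⊢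
  constructor <;> linarith

lemma tsec_comp_continuous {n : ℕ} (s : Eu n → ℂ) (hs : Continuous s) (P R : ℝ) (hP : 0 < P)
    (hR : R < P / 2) (h0 : ∀ x, R ≤ ‖x‖ → s x = 0) :
    Continuous (fun x : UnitAddTorus (Fin n) => s (tsec P x)) := by
  rw [continuous_iff_continuousAt]
  intro x
  by_cases hx : ∃ i, x i = ((-(1/2) : ℝ) : AddCircle (1:ℝ))
  · obtain ⟨i, hi⟩ := hx
    have hn : ‖x i‖ = 1/2 := by
      rw [hi, (AddCircle.norm_coe_eq_abs_iff _ one_ne_zero).2 (by norm_num [abs_of_pos])]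
      norm_num [abs_of_pos]
    have hc : ContinuousAt (fun y : UnitAddTorus (Fin n) => ‖y i‖) x :=
      ((continuous_apply i).norm).continuousAt
    have hlt : R / P < ‖x i‖ := by
      rw [hn, div_lt_iff₀ hP]; linarith
    have hev : ∀ᶠ y in nhds x, s (tsec P y) = 0 := by
      filter_upwards [hc.eventually (lt_mem_nhds hlt)] with y hy
      apply h0
      have h1 : ‖(tsec P y) i‖ ≤ ‖tsec P y‖ := PiLp.norm_apply_le _ _
      refine le_trans ?_ h1
      simp only [tsec, norm_mul, Real.norm_eq_abs, abs_of_pos hP]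
      rw [abs_equivIco]
      rw [div_lt_iff₀ hP] at hy
      linarith
    refine ContinuousAt.congr (f := fun _ => (0:ℂ)) continuousAt_const ?_
    filter_upwards [hev] with y hy using hy.symm
  · push Not at hx
    refine ContinuousAt.comp hs.continuousAt ?_
    unfold tsec
    refine ((PiLp.continuous_toLp 2 _).continuousAt).comp ?_
    rw [continuousAt_pi]
    intro i
    refine ContinuousAt.mul continuousAt_const ?_
    have := AddCircle.continuousAt_equivIco (1:ℝ) (-(1/2)) (hx i)
    have h2 : ContinuousAt (fun y : UnitAddTorus (Fin n) => y i) x :=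
      (continuous_apply i).continuousAt
    exact ContinuousAt.comp (f := fun y : UnitAddTorus (Fin n) => y i)
      (g := fun z => ((AddCircle.equivIco (1:ℝ) (-(1/2)) z).1 : ℝ))
      (continuous_subtype_val.continuousAt.comp this) h2

lemma tsec_coe {n : ℕ} (s : Eu n → ℂ) (P R : ℝ) (hP : 0 < P)
    (hR : R < P / 2) (h0 : ∀ x, R ≤ ‖x‖ → s x = 0) (x : Fin n → ℝ)
    (hx : ∀ i, x i ∈ Set.Icc (-(1/2) : ℝ) (1/2)) :
    s (tsec P (fun i => (x i : AddCircle (1:ℝ)))) = s (WithLp.toLp 2 (P • x)) := by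
  by_cases h : ∀ i, x i ∈ Set.Ico (-(1/2) : ℝ) (-(1/2)+1)
  · congr 1
    unfold tsec
    congr 1
    ext i
    rw [AddCircle.equivIco_coe_of_mem (h i)]
    rfl
  · push Not at h
    obtain ⟨i, hi⟩ := h
    have hi' : x i = 1/2 := by
      have := hx i
      simp only [Set.mem_Ico, Set.mem_Icc, not_and, not_lt] at hi this
      have := hi this.1
      linarith
    rw [h0, h0]
    · refine le_trans ?_ (PiLp.norm_apply_le _ i)
      simp only [Pi.smul_apply, smul_eq_mul, hi', norm_mul, Real.norm_eq_abs, abs_of_pos hP]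
      norm_num [abs_of_pos]
      linarith
    · refine le_trans ?_ (PiLp.norm_apply_le _ i)
      simp only [tsec, norm_mul, Real.norm_eq_abs, abs_of_pos hP, abs_equivIco]
      rw [hi', (AddCircle.norm_coe_eq_abs_iff _ one_ne_zero).2 (by norm_num [abs_of_pos])]
      norm_num [abs_of_pos]
      linarith

lemma mFourier_coe {n : ℕ} (m : Fin n → ℤ) (x : Fin n → ℝ) (P : ℝ) (hP : 0 < P) :
    UnitAddTorus.mFourier m (fun i => (x i : AddCircle (1:ℝ))) =
      Complex.exp (Complex.I * ((⟪(WithLp.toLp 2 (P • x) : Eu n), qv (2 * π / P) m⟫ : ℝ) : ℂ)) := by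
  simp only [UnitAddTorus.mFourier, ContinuousMap.coe_mk, fourier_coe_apply]
  rw [← Complex.exp_sum]
  congr 1
  simp only [PiLp.inner_apply, qv, Pi.smul_apply, smul_eq_mul, RCLike.inner_apply, conj_trivial]
  push_cast
  rw [Finset.mul_sum]
  refine Finset.sum_congr rfl fun i _ => ?_
  have : (P:ℂ) ≠ 0 := by exact_mod_cast hP.ne'
  field_simp

lemma mFourierCoeff_tsec {n : ℕ} (s : Eu n → ℂ) (P R : ℝ) (hP : 0 < P)
    (hR : R < P / 2) (h0 : ∀ x, R ≤ ‖x‖ → s x = 0) (m : Fin n → ℤ) :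
    UnitAddTorus.mFourierCoeff (fun x : UnitAddTorus (Fin n) => s (tsec P x)) m =
      (((P ^ n)⁻¹ : ℝ) : ℂ) * FT s (qv (2 * π / P) m) := by
  rw [UnitAddTorus.mFourierCoeff_eq_integral _ _ (fun _ => -(1/2))]
  set G : Eu n → ℂ := fun x => s x *
    Complex.exp (-(Complex.I * ((⟪x, qv (2 * π / P) m⟫ : ℝ) : ℂ))) with hG
  have h1 : ∀ x ∈ {x : Fin n → ℝ | ∀ i, x i ∈ Set.Ioc (-(1/2) : ℝ) (-(1/2) + 1)},
      (UnitAddTorus.mFourier (-m)) (fun i => (x i : AddCircle (1:ℝ))) •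
        s (tsec P (fun i => (x i : AddCircle (1:ℝ)))) = G (P • (WithLp.toLp 2 x)) := by
    intro x hx
    rw [tsec_coe s P R hP hR h0 x (fun i => by
      have := hx i; simp only [Set.mem_Ioc, Set.mem_Icc] at this ⊢
      constructor <;> linarith)]
    rw [mFourier_coe _ _ P hP, smul_eq_mul, mul_comm, hG]
    simp only [WithLp.toLp_smul]
    congr 2
    have : (qv (2 * π / P) (-m) : Eu n) = - qv (2 * π / P) m := by
      ext i; simp [qv]
    rw [this, inner_neg_right]
    push_cast; ring
  rw [setIntegral_congr_fun (MeasurableSet.univ_pi' (fun _ => measurableSet_Ioc)) h1]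
  rw [setIntegral_eq_integral_of_forall_compl_eq_zero]
  · have e := (EuclideanSpace.volume_preserving_symm_measurableEquiv_toLp (Fin n)).integral_comp'
      (f := (MeasurableEquiv.toLp 2 (Fin n → ℝ)).symm) (fun x : Fin n → ℝ => G (P • (WithLp.toLp 2 x)))
    rw [← e]
    have e2 := Measure.integral_comp_smul (volume : Measure (Eu n)) G P
    refine Eq.trans ?_ (e2.trans ?_)
    · rfl
    · simp only [finrank_euclideanSpace, Fintype.card_fin]
      rw [abs_of_pos (by positivity), Complex.real_smul]
      rfl
  · intro x hx
    simp only [Set.mem_ofPred_eq, not_forall] at hx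
    obtain ⟨i, hi⟩ := hx
    rw [hG]
    simp only
    rw [h0, zero_mul]
    refine le_trans ?_ (PiLp.norm_apply_le _ i)
    simp only [PiLp.smul_apply, smul_eq_mul, norm_mul, Real.norm_eq_abs, abs_of_pos hP]
    have : 1/2 ≤ |x i| := by
      by_contra hc
      push Not at hc
      rw [abs_lt] at hc
      exact hi ⟨by linarith, by linarith⟩
    nlinarith

lemma fourier_series {n : ℕ} (s : Eu n → ℂ) (hs : Continuous s) (P R : ℝ) (hP : 0 < P)
    (hR : R < P / 2) (h0 : ∀ x, R ≤ ‖x‖ → s x = 0)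
    (hsum : Summable fun m : Fin n → ℤ => ‖FT s (qv (2 * π / P) m)‖) (z : Eu n)
    (hz : ‖z‖ ≤ P / 2) :
    HasSum (fun m : Fin n → ℤ => (((P ^ n)⁻¹ : ℝ) : ℂ) * FT s (qv (2 * π / P) m) *
      Complex.exp (Complex.I * ((⟪z, qv (2 * π / P) m⟫ : ℝ) : ℂ))) (s z) := by
  let h : C(UnitAddTorus (Fin n), ℂ) := ⟨_, tsec_comp_continuous s hs P R hP hR h0⟩
  have hco : ∀ m, UnitAddTorus.mFourierCoeff h m =
      (((P ^ n)⁻¹ : ℝ) : ℂ) * FT s (qv (2 * π / P) m) :=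
    mFourierCoeff_tsec s P R hP hR h0
  have hsm : Summable (UnitAddTorus.mFourierCoeff h) := by
    have : UnitAddTorus.mFourierCoeff h = fun m =>
      (((P ^ n)⁻¹ : ℝ) : ℂ) * FT s (qv (2 * π / P) m) := funext hco
    rw [this]
    exact (Summable.of_norm hsum).mul_left _
  let x : Fin n → ℝ := fun i => P⁻¹ * z i
  have hx : WithLp.toLp 2 (P • x) = z := by
    ext i; simp [x, hP.ne']
  have := UnitAddTorus.hasSum_mFourier_series_apply_of_summable hsm
    (fun i => (x i : AddCircle (1:ℝ)))
  have hz' : h (fun i => (x i : AddCircle (1:ℝ))) = s z := by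
    have := tsec_coe s P R hP hR h0 x (fun i => by
      have h1 : ‖z i‖ ≤ P / 2 := (PiLp.norm_apply_le _ i).trans hz
      rw [Real.norm_eq_abs, abs_le] at h1
      have h2 : z i = P * x i := by simp [x, hP.ne']
      rw [h2] at h1
      constructor <;> nlinarith)
    rw [hx] at this
    exact this
  rw [hz'] at this
  convert! this using 2 with m
  rw [hco, mFourier_coe m x P hP, hx, smul_eq_mul]
lemma qv_eq_smul {n : ℕ} (L : ℝ) (m : Fin n → ℤ) : (qv L m : Eu n) = L • qv 1 m := by
  ext i; simp [qv]

lemma summable_qv_norm {n : ℕ} (s : ℝ) (hs : (n : ℝ) < s) :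
    Summable fun m : Fin n → ℤ => ‖(qv 1 m : Eu n)‖ ^ (-s) := by
  let b := (EuclideanSpace.basisFun (Fin n) ℝ).toBasis
  let L := Submodule.span ℤ (Set.range b)
  let e : (Fin n → ℤ) ≃ L := (b.restrictScalars ℤ).equivFun.symm.toEquiv
  have hf : Module.finrank ℤ L = n := by
    rw [Module.finrank_eq_card_basis (b.restrictScalars ℤ), Fintype.card_fin]
  have h := ZLattice.summable_norm_rpow L (-s) (by rw [hf]; linarith)
  have h2 := (e.summable_iff).2 h
  refine h2.congr fun m => ?_
  simp only [Function.comp]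
  congr 1
  have : ((e m : L) : Eu n) = qv 1 m := by
    simp only [e, LinearEquiv.coe_toEquiv, Module.Basis.equivFun_symm_apply]
    push_cast
    simp only [Module.Basis.restrictScalars_apply]
    ext i
    simp [b, qv, Finset.sum_apply, Pi.single_apply]
  rw [← this]
  rfl

lemma summable_qv {n : ℕ} (L : ℝ) (hL : 0 < L) (s : ℝ) (hs : (n : ℝ) < s) :
    Summable fun m : Fin n → ℤ => (1 + ‖(qv L m : Eu n)‖ ^ 2) ^ (-s / 2) := by
  have h1 := (summable_qv_norm (n := n) s hs).mul_left (L ^ (-s))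
  have h2 : Summable fun m : Fin n → ℤ => if m = 0 then (1:ℝ) else 0 :=
    (hasSum_ite_eq 0 1).summable
  refine Summable.of_nonneg_of_le (fun m => by positivity) (fun m => ?_) (h1.add h2)
  have hs0 : 0 < s := lt_of_le_of_lt (Nat.cast_nonneg n) hs
  by_cases hm : m = 0
  · simp only [hm, if_true]
    have : (qv L (0 : Fin n → ℤ) : Eu n) = 0 := by ext i; simp [qv]
    rw [this]
    simp
    positivity
  · simp only [hm, if_false, add_zero]
    have hq : (qv 1 m : Eu n) ≠ 0 := by
      intro h
      apply hm
      ext i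
      have := congrArg (fun v : Eu n => v i) h
      simpa [qv] using this
    have hq' : 0 < ‖(qv 1 m : Eu n)‖ := norm_pos_iff.2 hq
    rw [qv_eq_smul, norm_smul, Real.norm_eq_abs, abs_of_pos hL,
      ← Real.mul_rpow hL.le hq'.le]
    have h3 : (L * ‖(qv 1 m : Eu n)‖) ^ (-s) = ((L * ‖(qv 1 m : Eu n)‖) ^ 2) ^ (-s / 2) := by
      rw [← Real.rpow_natCast, ← Real.rpow_mul (by positivity)]
      congr 1; push_cast; ring
    rw [h3]
    apply Real.rpow_le_rpow_of_nonpos (by positivity) (by linarith) (by linarith)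

lemma exp_weight_bound (α c : ℝ) (hα : 0 ≤ α) (hc : 0 < c) :
    ∃ C : ℝ, 0 < C ∧ ∀ r : ℝ, 0 ≤ r → (1 + r ^ 2) ^ (α / 2) * Real.exp (-c * r) ≤ C := by
  obtain ⟨N, hN⟩ := exists_nat_ge α
  refine ⟨Real.exp c * N.factorial / c ^ N, by positivity, fun r hr => ?_⟩
  have h1 : (1 + r ^ 2) ^ (α / 2) ≤ (1 + r) ^ N := by
    calc (1 + r ^ 2) ^ (α / 2) ≤ ((1 + r) ^ 2) ^ (α / 2) := by
          apply Real.rpow_le_rpow (by positivity) (by nlinarith) (by positivity)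
      _ = (1 + r) ^ α := by
          rw [← Real.rpow_natCast, ← Real.rpow_mul (by positivity)]
          congr 1; push_cast; ring
      _ ≤ (1 + r) ^ (N : ℝ) := Real.rpow_le_rpow_of_exponent_le (by linarith) hN
      _ = _ := Real.rpow_natCast _ _
  have h2 := Real.pow_div_factorial_le_exp (c * (1 + r)) (by positivity) N
  rw [div_le_iff₀ (by positivity), mul_pow] at h2
  rw [le_div_iff₀ (by positivity)]
  calc (1 + r ^ 2) ^ (α / 2) * Real.exp (-c * r) * c ^ N
      ≤ (1 + r) ^ N * Real.exp (-c * r) * c ^ N := by gcongr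
    _ = (c ^ N * (1 + r) ^ N) * Real.exp (-c * r) := by ring
    _ ≤ (Real.exp (c * (1 + r)) * N.factorial) * Real.exp (-c * r) := by gcongr
    _ = (Real.exp (c * (1 + r)) * Real.exp (-c * r)) * N.factorial := by ring
    _ = _ := by rw [← Real.exp_add]; congr 2; ring

lemma kernel_bound {n : ℕ} (α c γ CM C0 δ : ℝ) (hα : 0 ≤ α) (hCM : 0 < CM)
    (hC0 : ∀ r : ℝ, 0 ≤ r → (1 + r ^ 2) ^ (α / 2) * Real.exp (-c * r) ≤ C0)
    (hδ : 0 < δ) (hδ1 : δ ≤ 1) (q : Eu n) (v : ℝ)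
    (hv : v ≤ CM * ((1 + ‖q‖ ^ 2) ^ (-(γ + α) / 2) +
        (1 + ‖q‖ ^ 2) ^ (-γ / 2) * Real.exp (-c * δ * ‖q‖))) :
    v * (1 + ‖δ • q‖ ^ 2) ^ (α / 2) ≤ CM * (1 + C0) * (1 + ‖q‖ ^ 2) ^ (-γ / 2) := by
  have hn : ‖δ • q‖ = δ * ‖q‖ := by rw [norm_smul, Real.norm_eq_abs, abs_of_pos hδ]
  have h1 : (1 + ‖δ • q‖ ^ 2) ^ (α / 2) ≤ (1 + ‖q‖ ^ 2) ^ (α / 2) := by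
    apply Real.rpow_le_rpow (by positivity) _ (by positivity)
    have : ‖δ • q‖ ≤ ‖q‖ := by rw [hn]; nlinarith [norm_nonneg q]
    gcongr
  have h2 := hC0 (δ * ‖q‖) (by positivity)
  rw [← hn] at h2
  have h3 : -c * δ * ‖q‖ = -c * ‖δ • q‖ := by rw [hn]; ring
  rw [h3] at hv
  have h4 : (1 + ‖q‖ ^ 2) ^ (-(γ + α) / 2) * (1 + ‖q‖ ^ 2) ^ (α / 2) =
      (1 + ‖q‖ ^ 2) ^ (-γ / 2) := by
    rw [← Real.rpow_add (by positivity)]; congr 1; ring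
  calc v * (1 + ‖δ • q‖ ^ 2) ^ (α / 2) ≤ (CM * ((1 + ‖q‖ ^ 2) ^ (-(γ + α) / 2) +
        (1 + ‖q‖ ^ 2) ^ (-γ / 2) * Real.exp (-c * ‖δ • q‖))) * (1 + ‖δ • q‖ ^ 2) ^ (α / 2) := by
        gcongr
    _ = CM * ((1 + ‖q‖ ^ 2) ^ (-(γ + α) / 2) * (1 + ‖δ • q‖ ^ 2) ^ (α / 2) +
        (1 + ‖q‖ ^ 2) ^ (-γ / 2) * ((1 + ‖δ • q‖ ^ 2) ^ (α / 2) * Real.exp (-c * ‖δ • q‖))) := by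
        ring
    _ ≤ CM * ((1 + ‖q‖ ^ 2) ^ (-(γ + α) / 2) * (1 + ‖q‖ ^ 2) ^ (α / 2) +
        (1 + ‖q‖ ^ 2) ^ (-γ / 2) * C0) := by gcongr
    _ = _ := by rw [h4]; ring

lemma peetre {n : ℕ} (x y : Eu n) (α : ℝ) (hα : 0 ≤ α) :
    (1 + ‖x‖ ^ 2) ^ (α / 2) ≤
      2 ^ (α / 2) * ((1 + ‖x + y‖ ^ 2) ^ (α / 2) * (1 + ‖y‖ ^ 2) ^ (α / 2)) := by
  rw [← Real.mul_rpow (by positivity) (by positivity),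
    ← Real.mul_rpow (by positivity) (by positivity)]
  apply Real.rpow_le_rpow (by positivity) _ (by positivity)
  have h : ‖x‖ ≤ ‖x + y‖ + ‖y‖ := by
    calc ‖x‖ = ‖(x + y) - y‖ := by simp
      _ ≤ _ := norm_sub_le _ _
  have h2 : ‖x‖ ^ 2 ≤ (‖x + y‖ + ‖y‖) ^ 2 := by gcongr
  nlinarith [sq_nonneg (‖x + y‖ - ‖y‖), sq_nonneg (‖x+y‖ * ‖y‖)]
lemma norm_exp_I_mul (r : ℝ) : ‖Complex.exp (Complex.I * (r : ℂ))‖ = 1 := by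
  rw [mul_comm]; exact Complex.norm_exp_ofReal_mul_I r

lemma osc_continuous {n : ℕ} (A : Eu n → ℂ) (hA : Integrable A) :
    Continuous fun x : Eu n => ∫ ξ, A ξ * Complex.exp (Complex.I * ((⟪x, ξ⟫ : ℝ) : ℂ)) := by
  refine continuous_of_dominated (bound := fun ξ => ‖A ξ‖) ?_ ?_ hA.norm ?_
  · intro x
    exact hA.aestronglyMeasurable.mul (Continuous.aestronglyMeasurable (by fun_prop))
  · intro x
    refine Filter.Eventually.of_forall fun ξ => ?_
    rw [norm_mul, norm_exp_I_mul, mul_one]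
  · refine Filter.Eventually.of_forall fun ξ => ?_
    fun_prop

lemma osc_integrable {n : ℕ} (A : Eu n → ℂ) (hA : Integrable A) (x : Eu n) :
    Integrable fun ξ => A ξ * Complex.exp (Complex.I * ((⟪x, ξ⟫ : ℝ) : ℂ)) := by
  refine hA.mono (hA.aestronglyMeasurable.mul (Continuous.aestronglyMeasurable (by fun_prop))) ?_
  refine Filter.Eventually.of_forall fun ξ => ?_
  rw [norm_mul, norm_exp_I_mul, mul_one]

lemma FT_continuous {n : ℕ} (f : Eu n → ℂ) (hf : Integrable f) : Continuous (FT f) := by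
  have h := (osc_continuous f hf).comp (continuous_neg (G := Eu n))
  refine h.congr fun ξ => ?_
  unfold FT
  simp only [Function.comp]
  congr 1
  ext x
  rw [inner_neg_left, real_inner_comm]
  push_cast
  congr 2
  ring

lemma hasSum_double {n : ℕ} {ι : Type*} [Countable ι] (s : Eu n → ℂ) (c : ι → ℂ) (q : ι → Eu n)
    (r δ t : ℝ) (hc : Summable fun m => ‖c m‖)
    (hs : ∀ z : Eu n, ‖z‖ ≤ r → HasSum (fun m => c m *
      Complex.exp (Complex.I * ((⟪z, q m⟫ : ℝ) : ℂ))) (s z))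
    (A B : Eu n → ℂ) (hA : Integrable A) (hB : Integrable B)
    (hAB : ∀ ξ η, A ξ ≠ 0 → B η ≠ 0 → ‖δ • (t • ξ + η)‖ ≤ r) (x : Eu n) :
    HasSum (fun m => c m *
        (∫ ξ, A ξ * Complex.exp (Complex.I * ((⟪x + t • (δ • q m), ξ⟫ : ℝ) : ℂ))) *
        (∫ η, B η * Complex.exp (Complex.I * ((⟪x + δ • q m, η⟫ : ℝ) : ℂ))))
      (∫ ξ, ∫ η, s (δ • (t • ξ + η)) * (A ξ * B η) *
        Complex.exp (Complex.I * ((⟪x, ξ⟫ + ⟪x, η⟫ : ℝ) : ℂ))) := by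
  set E : Eu n → Eu n → ℂ := fun y ξ => Complex.exp (Complex.I * ((⟪y, ξ⟫ : ℝ) : ℂ)) with hE
  have hEn : ∀ y ξ, ‖E y ξ‖ = 1 := fun y ξ => norm_exp_I_mul _
  set Gm : ι → ℂ := fun m => ∫ η, B η * E (x + δ • q m) η with hGm
  have hGmn : ∀ m, ‖Gm m‖ ≤ ∫ η, ‖B η‖ := by
    intro m
    refine (norm_integral_le_integral_norm _).trans (le_of_eq ?_)
    congr 1; ext η; rw [norm_mul, hEn, mul_one]
  have key : ∀ (m : ι) (ξ η : Eu n), c m *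
      Complex.exp (Complex.I * ((⟪δ • (t • ξ + η), q m⟫ : ℝ) : ℂ)) * (A ξ * B η) *
        Complex.exp (Complex.I * ((⟪x, ξ⟫ + ⟪x, η⟫ : ℝ) : ℂ)) =
      (c m * (A ξ * E (x + t • (δ • q m)) ξ)) * (B η * E (x + δ • q m) η) := by
    intro m ξ η
    have : Complex.exp (Complex.I * ((⟪δ • (t • ξ + η), q m⟫ : ℝ) : ℂ)) *
        Complex.exp (Complex.I * ((⟪x, ξ⟫ + ⟪x, η⟫ : ℝ) : ℂ)) =
        E (x + t • (δ • q m)) ξ * E (x + δ • q m) η := by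
      simp only [hE]
      rw [← Complex.exp_add, ← Complex.exp_add]
      congr 1
      rw [real_inner_comm (q m) (δ • (t • ξ + η))]
      simp only [inner_add_left, inner_add_right, inner_smul_left, inner_smul_right, conj_trivial]
      push_cast
      ring
    linear_combination (c m * (A ξ * B η)) * this
  have inner : ∀ ξ, HasSum (fun m => (c m * (A ξ * E (x + t • (δ • q m)) ξ)) * Gm m)
      (∫ η, s (δ • (t • ξ + η)) * (A ξ * B η) *
        Complex.exp (Complex.I * ((⟪x, ξ⟫ + ⟪x, η⟫ : ℝ) : ℂ))) := by
    intro ξ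
    have := hasSum_integral_of_dominated_convergence (μ := (volume : Measure (Eu n)))
      (F := fun m η => (c m * (A ξ * E (x + t • (δ • q m)) ξ)) * (B η * E (x + δ • q m) η))
      (f := fun η => s (δ • (t • ξ + η)) * (A ξ * B η) *
        Complex.exp (Complex.I * ((⟪x, ξ⟫ + ⟪x, η⟫ : ℝ) : ℂ)))
      (fun m η => ‖c m‖ * (‖A ξ‖ * ‖B η‖)) ?_ ?_ ?_ ?_ ?_
    · simpa only [integral_const_mul] using this
    · intro m
      exact ((osc_integrable B hB _).const_mul _).aestronglyMeasurable
    · intro m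
      refine Filter.Eventually.of_forall fun η => le_of_eq ?_
      simp only [norm_mul, hEn]; ring
    · exact Filter.Eventually.of_forall fun η => hc.mul_right _
    · simp only [tsum_mul_right]
      exact (hB.norm.const_mul _).const_mul _
    · refine Filter.Eventually.of_forall fun η => ?_
      by_cases h : A ξ = 0 ∨ B η = 0
      · rcases h with h | h <;> simp [h]
      · push Not at h
        have h1 := (hs _ (hAB ξ η h.1 h.2)).mul_right ((A ξ * B η) *
          Complex.exp (Complex.I * ((⟪x, ξ⟫ + ⟪x, η⟫ : ℝ) : ℂ)))
        simp only [← key]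
        simpa only [mul_assoc] using h1
  have outer := hasSum_integral_of_dominated_convergence (μ := (volume : Measure (Eu n)))
      (F := fun m ξ => (c m * (A ξ * E (x + t • (δ • q m)) ξ)) * Gm m)
      (fun m ξ => ‖c m‖ * (‖A ξ‖ * ∫ η, ‖B η‖)) ?_ ?_ ?_ ?_ (Filter.Eventually.of_forall inner)
  · simpa only [integral_const_mul, integral_mul_const] using outer
  · intro m
    exact (((osc_integrable A hA _).const_mul _).mul_const _).aestronglyMeasurable
  · intro m
    refine Filter.Eventually.of_forall fun ξ => ?_
    simp only [norm_mul, hEn, one_mul, mul_assoc]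
    gcongr
    exact hGmn m
  · exact Filter.Eventually.of_forall fun ξ => hc.mul_right _
  · simp only [tsum_mul_right]
    exact (hA.norm.mul_const _).const_mul _
lemma rpow_tsum_le {ι : Type*} (f : ι → ℝ≥0∞) (p : ℝ) (hp : 0 < p) (hp1 : p ≤ 1) :
    (∑' i, f i) ^ p ≤ ∑' i, f i ^ p := by
  have h1 : Filter.Tendsto (fun s : Finset ι => (∑ i ∈ s, f i) ^ p) Filter.atTop
      (nhds ((∑' i, f i) ^ p)) :=
    (ENNReal.continuous_rpow_const.tendsto _).comp ENNReal.summable.hasSum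
  refine le_of_tendsto' h1 fun s => ?_
  refine le_trans ?_ (ENNReal.sum_le_tsum s)
  classical
  induction s using Finset.induction_on with
  | empty => simp [hp]
  | insert a s ha ih =>
    rw [Finset.sum_insert ha, Finset.sum_insert ha]
    exact (ENNReal.rpow_add_le_add_rpow _ _ hp.le hp1).trans (by gcongr)

lemma rpow_tsum_weight_le {ι : Type*} (w f : ι → ℝ≥0∞) (p : ℝ) (hp1 : 1 ≤ p) :
    (∑' i, w i * f i) ^ p ≤ (∑' i, w i) ^ (p - 1) * ∑' i, w i * f i ^ p := by
  have h1 : Filter.Tendsto (fun s : Finset ι => (∑ i ∈ s, w i * f i) ^ p) Filter.atTop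
      (nhds ((∑' i, w i * f i) ^ p)) :=
    (ENNReal.continuous_rpow_const.tendsto _).comp ENNReal.summable.hasSum
  refine le_of_tendsto' h1 fun s => ?_
  have h2 := ENNReal.inner_le_weight_mul_Lp_of_nonneg s hp1 w f
  have hp : 0 < p := by linarith
  calc (∑ i ∈ s, w i * f i) ^ p
      ≤ ((∑ i ∈ s, w i) ^ (1 - p⁻¹) * (∑ i ∈ s, w i * f i ^ p) ^ p⁻¹) ^ p := by gcongr
    _ = (∑ i ∈ s, w i) ^ (p - 1) * (∑ i ∈ s, w i * f i ^ p) := by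
        rw [ENNReal.mul_rpow_of_nonneg _ _ hp.le, ← ENNReal.rpow_mul, ← ENNReal.rpow_mul,
          inv_mul_cancel₀ hp.ne', ENNReal.rpow_one]
        congr 2
        field_simp
    _ ≤ _ := by
        gcongr
        · exact ENNReal.sum_le_tsum s
        · exact ENNReal.sum_le_tsum s

lemma sum_norm_le_ge_one {n : ℕ} {ι : Type*} [Countable ι] (p : ℝ≥0∞) (hp : 1 ≤ p)
    (b : ι → ℝ≥0∞) (H : ι → Eu n → ℝ) (hH : ∀ m, Continuous (H m)) (K : ℝ≥0∞)
    (hK : ∀ m, eLpNorm (H m) p volume ≤ K) (T : Eu n → ℝ)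
    (hT : ∀ x, ‖T x‖ₑ ≤ ∑' m, b m * ‖H m x‖ₑ) :
    eLpNorm T p volume ≤ (∑' m, b m) * K := by
  have hp0 : p ≠ 0 := by rintro rfl; simp at hp
  by_cases htop : p = ∞
  · subst htop
    rw [eLpNorm_exponent_top]
    refine eLpNormEssSup_le_of_ae_enorm_bound ?_
    have : ∀ᵐ x : Eu n, ∀ m, ‖H m x‖ₑ ≤ K := by
      rw [ae_all_iff]
      intro m
      filter_upwards [ae_le_eLpNormEssSup (f := H m) (μ := volume)] with x hx
      refine hx.trans ?_
      have := hK m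
      rwa [eLpNorm_exponent_top] at this
    filter_upwards [this] with x hx
    refine (hT x).trans ?_
    rw [← ENNReal.tsum_mul_right]
    exact ENNReal.tsum_le_tsum fun m => by gcongr; exact hx m
  · have hr : 1 ≤ p.toReal := by
      rw [← ENNReal.toReal_one]; exact ENNReal.toReal_mono htop hp
    have hr0 : 0 < p.toReal := by linarith
    have hK' : ∀ m, ∫⁻ x, ‖H m x‖ₑ ^ p.toReal ≤ K ^ p.toReal := by
      intro m
      have := hK m
      rw [eLpNorm_eq_lintegral_rpow_enorm_toReal hp0 htop, one_div] at this
      rwa [ENNReal.rpow_inv_le_iff hr0] at this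
    rw [eLpNorm_eq_lintegral_rpow_enorm_toReal hp0 htop, one_div, ENNReal.rpow_inv_le_iff hr0,
      ENNReal.mul_rpow_of_nonneg _ _ hr0.le]
    calc ∫⁻ x, ‖T x‖ₑ ^ p.toReal
        ≤ ∫⁻ x, (∑' m, b m) ^ (p.toReal - 1) * ∑' m, b m * ‖H m x‖ₑ ^ p.toReal := by
          refine lintegral_mono fun x => ?_
          refine (ENNReal.rpow_le_rpow (hT x) hr0.le).trans ?_
          exact rpow_tsum_weight_le _ _ _ hr
      _ = (∑' m, b m) ^ (p.toReal - 1) * ∑' m, b m * ∫⁻ x, ‖H m x‖ₑ ^ p.toReal := by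
          have hme : ∀ m, Measurable fun x => ‖H m x‖ₑ ^ p.toReal := fun m =>
            ((hH m).measurable.enorm.pow_const _)
          rw [lintegral_const_mul]
          · rw [lintegral_tsum]
            · simp_rw [lintegral_const_mul _ (hme _)]
            · exact fun m => ((hme m).const_mul _).aemeasurable
          · exact Measurable.tsum fun m => (hme m).const_mul _
      _ ≤ (∑' m, b m) ^ (p.toReal - 1) * ∑' m, b m * K ^ p.toReal := by
          gcongr with m; exact hK' m
      _ = (∑' m, b m) ^ (p.toReal - 1) * (∑' m, b m) ^ (1:ℝ) * K ^ p.toReal := by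
          rw [ENNReal.tsum_mul_right, mul_assoc, ENNReal.rpow_one]
      _ = _ := by
          rw [← ENNReal.rpow_add_of_nonneg _ _ (by linarith) (by norm_num)]
          congr 2; ring

lemma sum_norm_le_lt_one {n : ℕ} {ι : Type*} [Countable ι] (p : ℝ≥0∞) (hp0 : p ≠ 0) (hp : p ≤ 1)
    (b : ι → ℝ≥0∞) (H : ι → Eu n → ℝ) (hH : ∀ m, Continuous (H m)) (K : ℝ≥0∞)
    (hK : ∀ m, eLpNorm (H m) p volume ≤ K) (T : Eu n → ℝ)
    (hT : ∀ x, ‖T x‖ₑ ≤ ∑' m, b m * ‖H m x‖ₑ) :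
    eLpNorm T p volume ≤ (∑' m, b m ^ p.toReal) ^ (1 / p.toReal) * K := by
  have htop : p ≠ ∞ := by rintro rfl; simp at hp
  have hr : p.toReal ≤ 1 := by
    rw [← ENNReal.toReal_one]; exact ENNReal.toReal_mono (by simp) hp
  have hr0 : 0 < p.toReal := ENNReal.toReal_pos hp0 htop
  have hK' : ∀ m, ∫⁻ x, ‖H m x‖ₑ ^ p.toReal ≤ K ^ p.toReal := by
    intro m
    have := hK m
    rw [eLpNorm_eq_lintegral_rpow_enorm_toReal hp0 htop, one_div] at this
    rwa [ENNReal.rpow_inv_le_iff hr0] at this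
  rw [eLpNorm_eq_lintegral_rpow_enorm_toReal hp0 htop, one_div, ENNReal.rpow_inv_le_iff hr0,
    ENNReal.mul_rpow_of_nonneg _ _ hr0.le, ENNReal.rpow_inv_rpow hr0.ne']
  calc ∫⁻ x, ‖T x‖ₑ ^ p.toReal
      ≤ ∫⁻ x, ∑' m, b m ^ p.toReal * ‖H m x‖ₑ ^ p.toReal := by
        refine lintegral_mono fun x => ?_
        refine (ENNReal.rpow_le_rpow (hT x) hr0.le).trans ?_
        refine (rpow_tsum_le _ _ hr0 hr).trans (le_of_eq ?_)
        simp_rw [ENNReal.mul_rpow_of_nonneg _ _ hr0.le]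
    _ = ∑' m, b m ^ p.toReal * ∫⁻ x, ‖H m x‖ₑ ^ p.toReal := by
        have hme : ∀ m, Measurable fun x => ‖H m x‖ₑ ^ p.toReal := fun m =>
          ((hH m).measurable.enorm.pow_const _)
        rw [lintegral_tsum]
        · simp_rw [lintegral_const_mul _ (hme _)]
        · exact fun m => ((hme m).const_mul _).aemeasurable
    _ ≤ ∑' m, b m ^ p.toReal * K ^ p.toReal := by
        gcongr with m; exact hK' m
    _ = _ := by rw [ENNReal.tsum_mul_right]

lemma enorm_le_top_norm {n : ℕ} (F : Eu n → ℝ) (hF : Continuous F) (x : Eu n) :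
    ‖F x‖ₑ ≤ eLpNorm F ∞ volume := by
  rw [eLpNorm_exponent_top]
  by_contra hcon
  push Not at hcon
  have hopen : IsOpen {y : Eu n | eLpNormEssSup F volume < ‖F y‖ₑ} :=
    isOpen_lt continuous_const hF.enorm
  have hz : volume {y : Eu n | eLpNormEssSup F volume < ‖F y‖ₑ} = 0 := by
    have := ae_le_eLpNormEssSup (f := F) (μ := volume)
    rw [ae_iff] at this
    simpa only [not_le] using this
  have := hopen.eq_empty_of_measure_zero hz
  have hx : x ∈ {y : Eu n | eLpNormEssSup F volume < ‖F y‖ₑ} := hcon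
  rw [this] at hx
  exact hx

lemma avg_continuous {n : ℕ} (F : Eu n → ℝ) (hF : Continuous F) (v : Eu n) :
    Continuous fun x => ∫ t in (0:ℝ)..1, F (x + t • v) := by
  apply intervalIntegral.continuous_parametric_intervalIntegral_of_continuous'
  unfold Function.uncurry
  fun_prop

lemma avg_norm_le {n : ℕ} (q : ℝ≥0∞) (hq : 1 ≤ q) (F : Eu n → ℝ) (hF : Continuous F) (v : Eu n) :
    eLpNorm (fun x => ∫ t in (0:ℝ)..1, F (x + t • v)) q volume ≤ eLpNorm F q volume := by
  have h0 : ∀ x, ‖∫ t in (0:ℝ)..1, F (x + t • v)‖ₑ ≤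
      ∫⁻ t in Set.Ioc (0:ℝ) 1, ‖F (x + t • v)‖ₑ := by
    intro x
    rw [intervalIntegral.integral_of_le zero_le_one]
    exact enorm_integral_le_lintegral_enorm _
  have hq0 : q ≠ 0 := by rintro rfl; simp at hq
  by_cases htop : q = ∞
  · subst htop
    conv_lhs => rw [eLpNorm_exponent_top]
    refine eLpNormEssSup_le_of_ae_enorm_bound (Filter.Eventually.of_forall fun x => ?_)
    refine (h0 x).trans ?_
    calc ∫⁻ t in Set.Ioc (0:ℝ) 1, ‖F (x + t • v)‖ₑ
        ≤ ∫⁻ t in Set.Ioc (0:ℝ) 1, eLpNorm F ∞ volume :=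
          lintegral_mono fun t => enorm_le_top_norm F hF _
      _ = _ := by simp
  · have hr : 1 ≤ q.toReal := by
      rw [← ENNReal.toReal_one]; exact ENNReal.toReal_mono htop hq
    have hr0 : 0 < q.toReal := by linarith
    rw [eLpNorm_eq_lintegral_rpow_enorm_toReal hq0 htop,
      eLpNorm_eq_lintegral_rpow_enorm_toReal hq0 htop]
    gcongr 1
    have hprob : IsProbabilityMeasure (volume.restrict (Set.Ioc (0:ℝ) 1)) := ⟨by simp⟩
    have hcF : Continuous fun z : Eu n × ℝ => F (z.1 + z.2 • v) := by fun_prop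
    calc ∫⁻ x, ‖∫ t in (0:ℝ)..1, F (x + t • v)‖ₑ ^ q.toReal
        ≤ ∫⁻ x, ∫⁻ t in Set.Ioc (0:ℝ) 1, ‖F (x + t • v)‖ₑ ^ q.toReal := by
          refine lintegral_mono fun x => ?_
          refine (ENNReal.rpow_le_rpow (h0 x) hr0.le).trans ?_
          have hc : Continuous fun t : ℝ => F (x + t • v) := by fun_prop
          have := eLpNorm'_le_eLpNorm'_of_exponent_le one_pos hr
            (volume.restrict (Set.Ioc (0:ℝ) 1)) hc.aestronglyMeasurable
          simp only [eLpNorm', ENNReal.rpow_one, one_div, inv_one] at this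
          rwa [ENNReal.le_rpow_inv_iff hr0] at this
      _ = ∫⁻ t in Set.Ioc (0:ℝ) 1, ∫⁻ x, ‖F (x + t • v)‖ₑ ^ q.toReal := by
          apply lintegral_lintegral_swap
          exact (hcF.measurable.enorm.pow_const _).aemeasurable
      _ = ∫⁻ t in Set.Ioc (0:ℝ) 1, ∫⁻ x, ‖F x‖ₑ ^ q.toReal := by
          congr 1; ext t
          exact lintegral_add_right_eq_self (fun x => ‖F x‖ₑ ^ q.toReal) (t • v)
      _ = _ := by simp

lemma wNorm_eq {n : ℕ} (p : ℝ≥0∞) (hp0 : p ≠ 0) (a : ℝ) (u : Eu n → ℂ) :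
    wNorm p a u =
      eLpNorm (fun x => (1 + ‖x‖ ^ 2) ^ (a / p.toReal / 2) * ‖u x‖) p volume := by
  unfold wNorm
  split_ifs with h
  · subst h
    rw [eLpNorm_exponent_top, eLpNormEssSup]
    congr 1
    ext x
    simp
    rfl
  · have hr0 : 0 < p.toReal := ENNReal.toReal_pos hp0 h
    rw [eLpNorm_eq_lintegral_rpow_enorm_toReal hp0 h]
    congr 2
    ext x
    rw [enorm_mul, enorm_norm, ENNReal.mul_rpow_of_nonneg _ _ hr0.le, mul_comm]
    congr 1
    unfold jweight
    rw [Real.enorm_of_nonneg (by positivity), ENNReal.ofReal_rpow_of_nonneg (by positivity) hr0.le,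
      ← Real.rpow_mul (by positivity)]
    congr 2
    field_simp

lemma H_norm_le {n : ℕ} (p p₁ p₂ : ℝ≥0∞) (hp1 : 1 ≤ p₁)
    (hexp : 1 / p = 1 / p₁ + 1 / p₂) (F G : Eu n → ℝ) (hF : Continuous F) (hG : Continuous G)
    (v : Eu n) :
    eLpNorm (fun x => (∫ t in (0:ℝ)..1, F (x + t • v)) * G (x + v)) p volume ≤
      eLpNorm F p₁ volume * eLpNorm G p₂ volume := by
  have : p₁.HolderTriple p₂ p := ⟨by simpa only [one_div] using hexp.symm⟩
  have hGv : Continuous fun x => G (x + v) := by fun_prop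
  have h1 := eLpNorm_smul_le_mul_eLpNorm (p := p₁) (q := p₂) (r := p) (μ := volume)
    hGv.aestronglyMeasurable (avg_continuous F hF v).aestronglyMeasurable
  refine h1.trans ?_
  gcongr
  · exact avg_norm_le p₁ hp1 F hF v
  · refine le_of_eq ?_
    exact eLpNorm_comp_measurePreserving hG.aestronglyMeasurable
      (measurePreserving_add_right volume v)
/-- the oscillatory integral -/
def osc {n : ℕ} (A : Eu n → ℂ) (x : Eu n) : ℂ :=
  ∫ ξ, A ξ * Complex.exp (Complex.I * ((⟪x, ξ⟫ : ℝ) : ℂ))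

lemma weight_ineq {n : ℕ} (x v : Eu n) (t α₁ α₂ : ℝ) (ht0 : 0 ≤ t) (ht1 : t ≤ 1)
    (h1 : 0 ≤ α₁) (h2 : 0 ≤ α₂) :
    (1 + ‖x‖ ^ 2) ^ ((α₁ + α₂) / 2) ≤ 2 ^ ((α₁ + α₂) / 2) * (1 + ‖v‖ ^ 2) ^ ((α₁ + α₂) / 2) *
      ((1 + ‖x + t • v‖ ^ 2) ^ (α₁ / 2) * (1 + ‖x + v‖ ^ 2) ^ (α₂ / 2)) := by
  have e1 := peetre x (t • v) α₁ h1
  have e2 := peetre x v α₂ h2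
  have e3 : (1 + ‖t • v‖ ^ 2) ^ (α₁ / 2) ≤ (1 + ‖v‖ ^ 2) ^ (α₁ / 2) := by
    apply Real.rpow_le_rpow (by positivity) _ (by positivity)
    have : ‖t • v‖ ≤ ‖v‖ := by
      rw [norm_smul, Real.norm_eq_abs, abs_of_nonneg ht0]; nlinarith [norm_nonneg v]
    gcongr
  simp only [add_div]
  rw [Real.rpow_add (by positivity), Real.rpow_add (by positivity), Real.rpow_add (by positivity)]
  calc (1 + ‖x‖ ^ 2) ^ (α₁ / 2) * (1 + ‖x‖ ^ 2) ^ (α₂ / 2)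
      ≤ (2 ^ (α₁ / 2) * ((1 + ‖x + t • v‖ ^ 2) ^ (α₁ / 2) * (1 + ‖v‖ ^ 2) ^ (α₁ / 2))) *
        (2 ^ (α₂ / 2) * ((1 + ‖x + v‖ ^ 2) ^ (α₂ / 2) * (1 + ‖v‖ ^ 2) ^ (α₂ / 2))) := by
        gcongr
        exact e1.trans (by gcongr)
    _ = _ := by ring

lemma pointwise_bound {n : ℕ} {ι : Type*} [Countable ι] (s : Eu n → ℂ) (c : ι → ℂ)
    (q : ι → Eu n) (r δ α₁ α₂ : ℝ) (h1 : 0 ≤ α₁) (h2 : 0 ≤ α₂) (hc : Summable fun m => ‖c m‖)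
    (hs : ∀ z : Eu n, ‖z‖ ≤ r → HasSum (fun m => c m *
      Complex.exp (Complex.I * ((⟪z, q m⟫ : ℝ) : ℂ))) (s z))
    (A B : Eu n → ℂ) (hA : Integrable A) (hB : Integrable B)
    (hAB : ∀ t : ℝ, 0 ≤ t → t ≤ 1 → ∀ ξ η, A ξ ≠ 0 → B η ≠ 0 → ‖δ • (t • ξ + η)‖ ≤ r)
    (x : Eu n) :
    ‖(1 + ‖x‖ ^ 2) ^ ((α₁ + α₂) / 2) * ‖∫ t in (0:ℝ)..1, ∫ ξ, ∫ η,
        s (δ • (t • ξ + η)) * (A ξ * B η) *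
        Complex.exp (Complex.I * ((⟪x, ξ⟫ + ⟪x, η⟫ : ℝ) : ℂ))‖‖ₑ ≤
    ∑' m, ENNReal.ofReal (2 ^ ((α₁ + α₂) / 2) *
        (‖c m‖ * (1 + ‖δ • q m‖ ^ 2) ^ ((α₁ + α₂) / 2))) *
      ‖(∫ t in (0:ℝ)..1, (fun y => (1 + ‖y‖ ^ 2) ^ (α₁ / 2) * ‖osc A y‖) (x + t • (δ • q m))) *
        (fun y => (1 + ‖y‖ ^ 2) ^ (α₂ / 2) * ‖osc B y‖) (x + δ • q m)‖ₑ := by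
  set F : Eu n → ℝ := fun y => (1 + ‖y‖ ^ 2) ^ (α₁ / 2) * ‖osc A y‖ with hF
  set G : Eu n → ℝ := fun y => (1 + ‖y‖ ^ 2) ^ (α₂ / 2) * ‖osc B y‖ with hG
  have hF0 : ∀ y, 0 ≤ F y := fun y => by positivity
  have hG0 : ∀ y, 0 ≤ G y := fun y => by positivity
  have hFc : Continuous F := by
    have : Continuous (osc A) := osc_continuous A hA
    refine Continuous.mul (Continuous.rpow_const (by fun_prop) fun y => Or.inr (by positivity))
      this.norm
  set b : ι → ℝ := fun m => 2 ^ ((α₁ + α₂) / 2) *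
        (‖c m‖ * (1 + ‖δ • q m‖ ^ 2) ^ ((α₁ + α₂) / 2)) with hb
  have hb0 : ∀ m, 0 ≤ b m := fun m => by positivity
  set I : ℝ → ℂ := fun t => ∫ ξ, ∫ η, s (δ • (t • ξ + η)) * (A ξ * B η) *
        Complex.exp (Complex.I * ((⟪x, ξ⟫ + ⟪x, η⟫ : ℝ) : ℂ)) with hI
  set W : ℝ := (1 + ‖x‖ ^ 2) ^ ((α₁ + α₂) / 2) with hW
  have hW0 : 0 ≤ W := by positivity
  have hterm : ∀ t ∈ Set.Ioc (0:ℝ) 1, ‖W‖ₑ * ‖I t‖ₑ ≤ ∑' m, ENNReal.ofReal (b m) *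
      ENNReal.ofReal (G (x + δ • q m)) * ENNReal.ofReal (F (x + t • (δ • q m))) := by
    intro t ht
    have hsum := hasSum_double s c q r δ t hc hs A B hA hB (hAB t ht.1.le ht.2) x
    have : I t = _ := hsum.tsum_eq.symm
    rw [this]
    calc _ ≤ ‖W‖ₑ * ∑' m, _ := by gcongr; exact enorm_tsum_le_tsum_enorm
      _ = ∑' m, _ := by rw [← ENNReal.tsum_mul_left]
      _ ≤ _ := by
        refine ENNReal.tsum_le_tsum fun m => ?_
        rw [← ENNReal.ofReal_mul (hb0 m), ← ENNReal.ofReal_mul (mul_nonneg (hb0 m) (hG0 _)),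
          ← enorm_norm (_ * _ * _), ← enorm_mul, Real.enorm_of_nonneg (by positivity)]
        apply ENNReal.ofReal_le_ofReal
        have hw := weight_ineq x (δ • q m) t α₁ α₂ ht.1.le ht.2 h1 h2
        simp only [norm_mul]
        change W * (‖c m‖ * ‖osc A (x + t • δ • q m)‖ * ‖osc B (x + δ • q m)‖) ≤ _
        calc _ ≤ (2 ^ ((α₁ + α₂) / 2) * (1 + ‖δ • q m‖ ^ 2) ^ ((α₁ + α₂) / 2) *
            ((1 + ‖x + t • δ • q m‖ ^ 2) ^ (α₁ / 2) * (1 + ‖x + δ • q m‖ ^ 2) ^ (α₂ / 2))) *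
            (‖c m‖ * ‖osc A (x + t • δ • q m)‖ * ‖osc B (x + δ • q m)‖) := by gcongr
          _ = _ := by simp only [hb, hF, hG]; ring
  rw [enorm_mul, enorm_norm, intervalIntegral.integral_of_le zero_le_one]
  calc ‖W‖ₑ * ‖∫ t in Set.Ioc (0:ℝ) 1, I t‖ₑ
      ≤ ‖W‖ₑ * ∫⁻ t in Set.Ioc (0:ℝ) 1, ‖I t‖ₑ := by
        gcongr; exact enorm_integral_le_lintegral_enorm _
    _ = ∫⁻ t in Set.Ioc (0:ℝ) 1, ‖W‖ₑ * ‖I t‖ₑ := by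
        rw [lintegral_const_mul' _ _ enorm_ne_top]
    _ ≤ ∫⁻ t in Set.Ioc (0:ℝ) 1, ∑' m, ENNReal.ofReal (b m) *
      ENNReal.ofReal (G (x + δ • q m)) * ENNReal.ofReal (F (x + t • (δ • q m))) :=
        setLIntegral_mono' measurableSet_Ioc hterm
    _ = ∑' m, ENNReal.ofReal (b m) * ENNReal.ofReal (G (x + δ • q m)) *
          ∫⁻ t in Set.Ioc (0:ℝ) 1, ENNReal.ofReal (F (x + t • (δ • q m))) := by
        have hm : ∀ m, Measurable fun t : ℝ => ENNReal.ofReal (F (x + t • (δ • q m))) := by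
          intro m
          have : Continuous fun t : ℝ => F (x + t • (δ • q m)) := by fun_prop
          exact this.measurable.ennreal_ofReal
        rw [lintegral_tsum (fun m => ((hm m).const_mul _).aemeasurable)]
        simp_rw [lintegral_const_mul _ (hm _)]
    _ = _ := by
        congr 1
        ext m
        have hcont : Continuous fun t : ℝ => F (x + t • (δ • q m)) := by fun_prop
        rw [intervalIntegral.integral_of_le zero_le_one, enorm_mul, Real.enorm_of_nonneg (hG0 _),
          Real.enorm_of_nonneg (integral_nonneg fun t => hF0 _),
          ofReal_integral_eq_lintegral_ofReal]
        · ring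
        · exact (hcont.integrableOn_Icc).mono_set Set.Ioc_subset_Icc_self
        · exact Filter.Eventually.of_forall fun t => hF0 _

lemma sum_const {n : ℕ} (p : ℝ≥0∞) (hp0 : p ≠ 0) (D L γ : ℝ) (hD : 0 ≤ D) (hL : 0 < L)
    (hγ : max ((n : ℝ) / p.toReal) (n : ℝ) < γ) :
    ∃ C : ℝ, 0 < C ∧ ∀ (H : (Fin n → ℤ) → Eu n → ℝ), (∀ m, Continuous (H m)) → ∀ K : ℝ≥0∞,
      (∀ m, eLpNorm (H m) p volume ≤ K) → ∀ T : Eu n → ℝ,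
      (∀ x, ‖T x‖ₑ ≤ ∑' m, ENNReal.ofReal (D * (1 + ‖(qv L m : Eu n)‖ ^ 2) ^ (-γ / 2)) *
        ‖H m x‖ₑ) → eLpNorm T p volume ≤ ENNReal.ofReal C * K := by
  have fin : ∀ X : ℝ≥0∞, X ≠ ∞ → X ≤ ENNReal.ofReal (X.toReal + 1) := by
    intro X hX
    rw [ENNReal.le_ofReal_iff_toReal_le hX (by positivity)]
    linarith
  have hpos : ∀ m : Fin n → ℤ, 0 < 1 + ‖(qv L m : Eu n)‖ ^ 2 := fun m => by positivity
  rcases le_total 1 p with h1 | h1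
  · have hs : Summable fun m : Fin n → ℤ => D * (1 + ‖(qv L m : Eu n)‖ ^ 2) ^ (-γ / 2) :=
      (summable_qv L hL γ ((le_max_right _ _).trans_lt hγ)).mul_left D
    refine ⟨_, by positivity, fun H hH K hK T hT =>
      (sum_norm_le_ge_one p h1 _ H hH K hK T hT).trans
        (mul_le_mul_left (fin _ ?_) K)⟩
    exact hs.tsum_ofReal_ne_top
  · have hpt : p ≠ ∞ := ne_top_of_le_ne_top ENNReal.one_ne_top h1
    have hpr : 0 < p.toReal := ENNReal.toReal_pos hp0 hpt
    have hg : (n : ℝ) < γ * p.toReal := by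
      have := (le_max_left _ _).trans_lt hγ
      rwa [div_lt_iff₀ hpr] at this
    have hs : Summable fun m : Fin n → ℤ => D ^ p.toReal *
        (1 + ‖(qv L m : Eu n)‖ ^ 2) ^ (-(γ * p.toReal) / 2) :=
      (summable_qv L hL _ hg).mul_left _
    refine ⟨_, by positivity, fun H hH K hK T hT =>
      (sum_norm_le_lt_one p hp0 h1 _ H hH K hK T hT).trans
        (mul_le_mul_left (fin _ ?_) K)⟩
    refine ENNReal.rpow_ne_top_of_nonneg (by positivity) ?_
    have := hs.tsum_ofReal_ne_top
    convert this using 3 with m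
    rw [ENNReal.ofReal_rpow_of_nonneg (mul_nonneg hD (Real.rpow_nonneg (hpos m).le _)) hpr.le,
      Real.mul_rpow hD (Real.rpow_nonneg (hpos m).le _), ← Real.rpow_mul (hpos m).le]
    congr 3
    ring

lemma cut_integrable {n : ℕ} (Φ : Eu n → ℝ) (hΦ : IsLPBump Φ) (d : ℝ) (hd : 0 < d)
    (f : SchwartzMap (Eu n) ℂ) :
    Integrable fun ξ : Eu n => ((Φ (d • ξ) : ℝ) : ℂ) * FT ⇑f ξ := by
  have hc : Continuous (FT ⇑f) := FT_continuous _ f.integrable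
  have hP : Continuous Φ := hΦ.1.continuous
  refine Continuous.integrable_of_hasCompactSupport (by fun_prop) ?_
  refine HasCompactSupport.intro (isCompact_closedBall (0 : Eu n) (2 / d)) fun x hx => ?_
  have hx' : 2 / d < ‖x‖ := by simpa using hx
  rw [hΦ.2.2.2 (d • x), Complex.ofReal_zero, zero_mul]
  rw [norm_smul, Real.norm_of_nonneg hd.le]
  rw [div_lt_iff₀ hd] at hx'
  linarith

lemma SProj_eq {n : ℕ} (Φ : Eu n → ℝ) (k : ℤ) (f : Eu n → ℂ) :
    SProj Φ k f = osc (fun ξ => ((((2 * Real.pi) ^ n)⁻¹ : ℝ) : ℂ) *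
      (((Φ ((2 : ℝ) ^ (-k) • ξ) : ℝ) : ℂ) * FT f ξ)) := by
  ext x
  unfold SProj osc
  rw [← integral_const_mul]
  simp only [mul_assoc]

lemma DProj_eq {n : ℕ} (Φ : Eu n → ℝ) (hΦ : IsLPBump Φ) (k : ℤ) (f : SchwartzMap (Eu n) ℂ) :
    DProj Φ k f = osc (fun ξ => ((((2 * Real.pi) ^ n)⁻¹ : ℝ) : ℂ) *
      ((((Φ ((2 : ℝ) ^ (-k) • ξ) - Φ ((2 : ℝ) ^ (-(k - 1)) • ξ)) : ℝ) : ℂ) * FT ⇑f ξ)) := by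
  ext x
  unfold DProj
  rw [SProj_eq, SProj_eq]
  unfold osc
  rw [← integral_sub]
  · congr 1
    ext ξ
    push_cast
    ring
  · exact osc_integrable _ ((cut_integrable Φ hΦ _ (by positivity) f).const_mul _) x
  · exact osc_integrable _ ((cut_integrable Φ hΦ _ (by positivity) f).const_mul _) x

lemma weighted_continuous {n : ℕ} (A : Eu n → ℂ) (hA : Integrable A) (α : ℝ) :
    Continuous fun y : Eu n => (1 + ‖y‖ ^ 2) ^ (α / 2) * ‖osc A y‖ := by
  have h : Continuous (osc A) := osc_continuous A hA
  have h2 : Continuous fun y : Eu n => (1 + ‖y‖ ^ 2 : ℝ) ^ (α / 2) :=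
    Continuous.rpow_const (by fun_prop) fun y => Or.inl (by positivity)
  exact h2.mul h.norm
/-- **Key commutator multiplier lemma** (Lemma 3.7). -/
theorem key_commutator_multiplier_lemma (n : ℕ) (hn : 1 ≤ n)
    (p p₁ p₂ : ℝ≥0∞) (a a₁ a₂ : ℝ)
    (hp : 2⁻¹ ≤ p) (hp1 : 1 ≤ p₁) (hp2 : 1 ≤ p₂)
    (ha : 0 ≤ a) (ha1 : 0 ≤ a₁) (ha2 : 0 ≤ a₂)
    (hexp : 1 / p = 1 / p₁ + 1 / p₂)
    (hwexp : ENNReal.ofReal a / p = ENNReal.ofReal a₁ / p₁ + ENNReal.ofReal a₂ / p₂)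
    (σ : ℕ → Eu n → ℂ) (hσ : ∀ k, ContDiff ℝ (⊤ : ℕ∞) (σ k))
    (R : ℝ) (hR : 0 < R) (hsupp : ∀ k, tsupport (σ k) ⊆ Metric.ball (0 : Eu n) R)
    (γ : ℝ) (hγ : max ((n : ℝ) / p.toReal) (n : ℝ) < γ) (c : ℝ) (hc : 0 < c)
    (hdecay : ∀ M : ℝ, 0 < M → ∃ CM : ℝ, 0 < CM ∧ ∀ k : ℕ, ∀ x : Eu n,
      ‖FT (σ k) x‖ ≤ CM * ((1 + ‖x‖ ^ 2) ^ (-M / 2) +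
        (1 + ‖x‖ ^ 2) ^ (-γ / 2) * Real.exp (-c * 2 ^ (-(k : ℝ)) * ‖x‖)))
    (Φ : Eu n → ℝ) (hΦ : IsLPBump Φ) :
    ∃ C : ℝ, 0 < C ∧ ∀ k : ℕ, ∀ f g : SchwartzMap (Eu n) ℂ,
      wNorm p a (fun x => ((((2 * Real.pi) ^ (2 * n))⁻¹ : ℝ) : ℂ) *
          ∫ t in (0 : ℝ)..1, ∫ ξ : Eu n, ∫ η : Eu n,
            σ k ((2 : ℝ) ^ (-(k : ℤ)) • (t • ξ + η)) *
              ((Φ ((2 : ℝ) ^ (-((k : ℤ) - 3)) • ξ) : ℝ) : ℂ) * FT ⇑f ξ *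
              (((Φ ((2 : ℝ) ^ (-(k : ℤ)) • η) - Φ ((2 : ℝ) ^ (-((k : ℤ) - 1)) • η)) : ℝ) : ℂ) *
              FT ⇑g η *
              Complex.exp (Complex.I * ((⟪x, ξ⟫ + ⟪x, η⟫ : ℝ) : ℂ))) ≤
        ENNReal.ofReal C *
          (wNorm p₁ a₁ (SProj Φ ((k : ℤ) - 3) ⇑f) * wNorm p₂ a₂ (DProj Φ (k : ℤ) ⇑g)) := by
  have hp0 : p ≠ 0 := by
    rintro rfl
    simp at hp
  have hp10 : p₁ ≠ 0 := by
    rintro rfl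
    simp at hp1
  have hp20 : p₂ ≠ 0 := by
    rintro rfl
    simp at hp2
  set α₁ : ℝ := a₁ / p₁.toReal with hα₁
  set α₂ : ℝ := a₂ / p₂.toReal with hα₂
  have h1 : 0 ≤ α₁ := by positivity
  have h2 : 0 ≤ α₂ := by positivity
  have hα : a / p.toReal = α₁ + α₂ := by
    have h := congrArg ENNReal.toReal hwexp
    rw [ENNReal.toReal_add (ENNReal.div_ne_top ENNReal.ofReal_ne_top hp10)
      (ENNReal.div_ne_top ENNReal.ofReal_ne_top hp20)] at h
    simpa [ENNReal.toReal_div, ENNReal.toReal_ofReal, ha, ha1, ha2] using h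
  have hα0 : 0 ≤ α₁ + α₂ := by positivity
  have hγn : (n : ℝ) < γ := (le_max_right _ _).trans_lt hγ
  have hγ0 : 0 < γ := lt_of_le_of_lt (Nat.cast_nonneg n) hγn
  obtain ⟨CM, hCM, hdec⟩ := hdecay (γ + (α₁ + α₂)) (by positivity)
  obtain ⟨C0, hC0, hexpw⟩ := exp_weight_bound (α₁ + α₂) c hα0 hc
  set P : ℝ := 2 * R + 5 with hPdef
  have hP : 0 < P := by positivity
  have hRP : R < P / 2 := by rw [hPdef]; linarith
  have hL : 0 < 2 * Real.pi / P := by positivity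
  set L : ℝ := 2 * Real.pi / P with hLdef
  set D : ℝ := 2 ^ ((α₁ + α₂) / 2) * ((P ^ n)⁻¹ * (CM * (1 + C0))) with hDdef
  have hD : 0 ≤ D := by positivity
  obtain ⟨C, hC, hmain⟩ := sum_const (n := n) p hp0 D L γ hD hL hγ
  refine ⟨C, hC, fun k f g => ?_⟩
  have hδ : (0 : ℝ) < (2 : ℝ) ^ (-(k : ℤ)) := by positivity
  have hδ1 : (2 : ℝ) ^ (-(k : ℤ)) ≤ 1 := zpow_le_one_of_nonpos₀ (by norm_num) (by simp)
  have hδ3 : (2 : ℝ) ^ (-((k : ℤ) - 3)) = 8 * (2 : ℝ) ^ (-(k : ℤ)) := by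
    rw [show (-((k : ℤ) - 3)) = 3 + -(k : ℤ) by ring, zpow_add₀ (by norm_num)]
    norm_num
  have hδ2 : (2 : ℝ) ^ (-((k : ℤ) - 1)) = 2 * (2 : ℝ) ^ (-(k : ℤ)) := by
    rw [show (-((k : ℤ) - 1)) = 1 + -(k : ℤ) by ring, zpow_add₀ (by norm_num)]
    norm_num
  have hδr : (2 : ℝ) ^ (-(k : ℝ)) = (2 : ℝ) ^ (-(k : ℤ)) := by
    rw [← Real.rpow_intCast]; push_cast; rfl
  have hker : ∀ m : Fin n → ℤ, ‖FT (σ k) (qv L m)‖ *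
      (1 + ‖(2 : ℝ) ^ (-(k : ℤ)) • (qv L m : Eu n)‖ ^ 2) ^ ((α₁ + α₂) / 2) ≤
      CM * (1 + C0) * (1 + ‖(qv L m : Eu n)‖ ^ 2) ^ (-γ / 2) := by
    intro m
    refine kernel_bound (α₁ + α₂) c γ CM C0 _ hα0 hCM hexpw hδ hδ1 _ _ ?_
    have := hdec k (qv L m)
    rwa [hδr] at this
  have hsumF : Summable fun m : Fin n → ℤ => ‖FT (σ k) (qv L m)‖ := by
    refine Summable.of_nonneg_of_le (fun m => norm_nonneg _) (fun m => ?_)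
      ((summable_qv L hL γ hγn).mul_left (CM * (1 + C0)))
    refine le_trans ?_ (hker m)
    refine le_mul_of_one_le_right (norm_nonneg _) (Real.one_le_rpow ?_ (by positivity))
    nlinarith [sq_nonneg ‖(2 : ℝ) ^ (-(k : ℤ)) • (qv L m : Eu n)‖]
  have hser := fourier_series (σ k) (hσ k).continuous P R hP hRP (fun x hx => by
    refine image_eq_zero_of_notMem_tsupport fun hx' => ?_
    have := hsupp k hx'
    rw [mem_ball_zero_iff] at this
    linarith) hsumF
  set κ : ℂ := ((((2 * Real.pi) ^ n)⁻¹ : ℝ) : ℂ) with hκ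
  set A : Eu n → ℂ := fun ξ => κ * (((Φ ((2 : ℝ) ^ (-((k : ℤ) - 3)) • ξ) : ℝ) : ℂ) * FT ⇑f ξ) with hA
  set B : Eu n → ℂ := fun ξ => κ * ((((Φ ((2 : ℝ) ^ (-(k : ℤ)) • ξ) -
    Φ ((2 : ℝ) ^ (-((k : ℤ) - 1)) • ξ)) : ℝ) : ℂ) * FT ⇑g ξ) with hB
  have hAi : Integrable A := (cut_integrable Φ hΦ _ (by positivity) f).const_mul _
  have hBi : Integrable B := by
    have := ((cut_integrable Φ hΦ ((2 : ℝ) ^ (-(k : ℤ))) (by positivity) g).sub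
      (cut_integrable Φ hΦ ((2 : ℝ) ^ (-((k : ℤ) - 1))) (by positivity) g)).const_mul κ
    convert this using 1
    ext ξ
    simp only [hB, Pi.sub_apply]
    push_cast
    ring
  have hSP : SProj Φ ((k : ℤ) - 3) ⇑f = osc A := SProj_eq _ _ _
  have hDP : DProj Φ (k : ℤ) ⇑g = osc B := DProj_eq _ hΦ _ _
  have hAB : ∀ t : ℝ, 0 ≤ t → t ≤ 1 → ∀ ξ η, A ξ ≠ 0 → B η ≠ 0 →
      ‖(2 : ℝ) ^ (-(k : ℤ)) • (t • ξ + η)‖ ≤ P / 2 := by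
    intro t ht0 ht1 ξ η hAξ hBη
    have e1 : 8 * ((2 : ℝ) ^ (-(k : ℤ)) * ‖ξ‖) < 2 := by
      by_contra hcon
      apply hAξ
      have : Φ ((2 : ℝ) ^ (-((k : ℤ) - 3)) • ξ) = 0 := by
        apply hΦ.2.2.2
        rw [norm_smul, Real.norm_of_nonneg (by positivity), hδ3]
        linarith
      simp only [hA, this]
      simp
    have e2 : (2 : ℝ) ^ (-(k : ℤ)) * ‖η‖ < 2 := by
      by_contra hcon
      push Not at hcon
      apply hBη
      have z1 : Φ ((2 : ℝ) ^ (-(k : ℤ)) • η) = 0 := by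
        apply hΦ.2.2.2
        rw [norm_smul, Real.norm_of_nonneg (by positivity)]
        exact hcon
      have z2 : Φ ((2 : ℝ) ^ (-((k : ℤ) - 1)) • η) = 0 := by
        apply hΦ.2.2.2
        rw [norm_smul, Real.norm_of_nonneg (by positivity), hδ2]
        linarith
      simp only [hB, z1, z2]
      simp
    have e3 : ‖t • ξ + η‖ ≤ ‖ξ‖ + ‖η‖ := by
      refine (norm_add_le _ _).trans ?_
      rw [norm_smul, Real.norm_of_nonneg ht0]
      nlinarith [norm_nonneg ξ]
    rw [norm_smul, Real.norm_of_nonneg hδ.le]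
    have e4 := mul_le_mul_of_nonneg_left e3 hδ.le
    rw [hPdef]
    nlinarith
  have hT : ∀ x : Eu n, ((((2 * Real.pi) ^ (2 * n))⁻¹ : ℝ) : ℂ) *
          ∫ t in (0 : ℝ)..1, ∫ ξ : Eu n, ∫ η : Eu n,
            σ k ((2 : ℝ) ^ (-(k : ℤ)) • (t • ξ + η)) *
              ((Φ ((2 : ℝ) ^ (-((k : ℤ) - 3)) • ξ) : ℝ) : ℂ) * FT ⇑f ξ *
              (((Φ ((2 : ℝ) ^ (-(k : ℤ)) • η) - Φ ((2 : ℝ) ^ (-((k : ℤ) - 1)) • η)) : ℝ) : ℂ) *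
              FT ⇑g η *
              Complex.exp (Complex.I * ((⟪x, ξ⟫ + ⟪x, η⟫ : ℝ) : ℂ)) =
      ∫ t in (0 : ℝ)..1, ∫ ξ : Eu n, ∫ η : Eu n,
        σ k ((2 : ℝ) ^ (-(k : ℤ)) • (t • ξ + η)) * (A ξ * B η) *
          Complex.exp (Complex.I * ((⟪x, ξ⟫ + ⟪x, η⟫ : ℝ) : ℂ)) := by
    intro x
    have hκ2 : ((((2 * Real.pi) ^ (2 * n))⁻¹ : ℝ) : ℂ) = κ * κ := by
      rw [hκ, ← Complex.ofReal_mul, ← mul_inv, ← pow_add, two_mul n]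
    rw [hκ2, ← intervalIntegral.integral_const_mul]
    simp only [← integral_const_mul]
    congr 1
    ext t
    congr 1
    ext ξ
    congr 1
    ext η
    simp only [hA, hB]
    ring
  simp only [hT]
  rw [hSP, hDP, wNorm_eq p hp0, wNorm_eq p₁ hp10, wNorm_eq p₂ hp20, hα, ← hα₁, ← hα₂]
  have hcA := weighted_continuous A hAi α₁
  have hcB := weighted_continuous B hBi α₂
  refine hmain (fun m x => (∫ t in (0:ℝ)..1, (fun y : Eu n => (1 + ‖y‖ ^ 2) ^ (α₁ / 2) * ‖osc A y‖)
      (x + t • ((2 : ℝ) ^ (-(k : ℤ)) • qv L m))) *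
      (fun y : Eu n => (1 + ‖y‖ ^ 2) ^ (α₂ / 2) * ‖osc B y‖) (x + (2 : ℝ) ^ (-(k : ℤ)) • qv L m))
    (fun m => ?_) _ (fun m => ?_) _ (fun x => ?_)
  · exact (avg_continuous _ hcA _).mul (hcB.comp (continuous_id.add continuous_const))
  · exact H_norm_le p p₁ p₂ hp1 hexp _ _ hcA hcB _
  · refine (pointwise_bound (σ k) (fun m => (((P ^ n)⁻¹ : ℝ) : ℂ) * FT (σ k) (qv L m))
      (fun m => qv L m) (P / 2) _ α₁ α₂ h1 h2 ?_ hser A B hAi hBi hAB x).trans ?_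
    · simp only [norm_mul]
      exact hsumF.mul_left _
    · refine ENNReal.tsum_le_tsum fun m => mul_le_mul_left (ENNReal.ofReal_le_ofReal ?_) _
      have hPn : ‖(((P ^ n)⁻¹ : ℝ) : ℂ)‖ = (P ^ n)⁻¹ := by
        rw [Complex.norm_real, Real.norm_of_nonneg (by positivity)]
      rw [norm_mul, hPn, hDdef, mul_assoc ((P ^ n)⁻¹), mul_assoc (2 ^ ((α₁ + α₂) / 2)),
        mul_assoc ((P ^ n)⁻¹)]
      have := hker m
      gcongr
end
end
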